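/- Let s ≥ 2 and for each m let P_m be a dyadic digital (t_m, m, s)-net in base 2 with t_m ≤ (1/10)·log₂ m. Put Ṡ_m = ∑_{k=1}^m 𝔇_k and ρ̇_m² = E^{(m)}_{Y,T}(Ṡ_m²). Then Ṡ_m/ρ̇_m converges weakly to the standard Gaussian distribution N(0,1) as m → ∞, i.e., for every w ∈ ℝ the fraction of digit choices (t_{i,j}, y_{i,j} ∈ {0,1}, 1 ≤ i ≤ s, 1 ≤ j ≤ m) with Ṡ_m(T^{(m)}, Y^{(m)})/ρ̇_m < w tends to Φ(w) = (2π)^{-1/2}∫_{-∞}^{w} e^{-u²/2} du. -/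

import Mathlib

open MeasureTheory Filter

noncomputable section

attribute [local instance] Classical.propDecidable

/-- The `a`-th binary digit (`a ≥ 1`) of the dyadic expansion of `x ∈ [0,1)`
(the finite expansion is used for dyadic rationals). -/
def bdigit (a : ℕ) (x : ℝ) : ℕ := (⌊x * 2 ^ a⌋).toNat % 2

/-- Digitwise addition modulo 2 of dyadic expansions: `x ⊕ y`. -/
def xorReal (x y : ℝ) : ℝ :=
  ∑' a : ℕ, (((bdigit (a + 1) x + bdigit (a + 1) y) % 2 : ℕ) : ℝ) / 2 ^ (a + 1)

/-- Coordinatewise digitwise addition `⊕` on vectors. -/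
def xorVec {s : ℕ} (X Y : Fin s → ℝ) : Fin s → ℝ := fun i => xorReal (X i) (Y i)

/-- Local discrepancy `D(P, Y)` of a finite point set `P` in `[0,1)^s`. -/
def Dloc {N s : ℕ} (P : Fin N → Fin s → ℝ) (Y : Fin s → ℝ) : ℝ :=
  (∑ n : Fin N, if ∀ i, 0 ≤ P n i ∧ P n i < Y i then (1 : ℝ) else 0) -
    (N : ℝ) * ∏ i, Y i

/-- `P` is a `(t,m,s)`-net in base 2: every elementary dyadic box of volume
`2^(t-m)` contains exactly `2^t` of the points. -/
def IsNet (t m s : ℕ) (P : Fin (2 ^ m) → Fin s → ℝ) : Prop :=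
  ∀ d a : Fin s → ℕ, (∀ i, a i < 2 ^ d i) → (∑ i, d i) + t = m →
    (Finset.univ.filter fun n => ∀ i,
        (a i : ℝ) / 2 ^ d i ≤ P n i ∧ P n i < ((a i : ℝ) + 1) / 2 ^ d i).card = 2 ^ t

/-- The digits `x_{n,i,j}` of the `n`-th point of the dyadic digital net with
generating matrices `C`. -/
def netDig (m s : ℕ) (C : Fin s → Matrix (Fin m) (Fin m) (ZMod 2)) (n : ℕ) :
    Fin s → Fin m → ZMod 2 :=
  fun i j => ∑ r : Fin m, C i j r * (if n.testBit r then 1 else 0)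

/-- The `n`-th point of the dyadic digital net with generating matrices `C`. -/
def netPoint (m s : ℕ) (C : Fin s → Matrix (Fin m) (Fin m) (ZMod 2)) (n : ℕ) :
    Fin s → ℝ :=
  fun i => ∑ j : Fin m, ((netDig m s C n i j).val : ℝ) / 2 ^ ((j : ℕ) + 1)

/-- The unit cube `[0,1]^s`. -/
def cube (s : ℕ) : Set (Fin s → ℝ) := Set.univ.pi fun _ => Set.Icc (0 : ℝ) 1

/-- The point of `Q^s(2^m)` with coordinates `T i / 2^m`. -/
def Qpt {s : ℕ} (m : ℕ) (T : Fin s → Fin (2 ^ m)) : Fin s → ℝ :=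
  fun i => ((T i : ℕ) : ℝ) / 2 ^ m

/-- `M_{s,p}(P) = (2^{-sm} ∑_{T ∈ Q^s(2^m)} ∫_{[0,1]^s} |D(P ⊕ T, Y)|^p dY)^{1/p}`. -/
def Msp (s m : ℕ) (p : ℝ) {N : ℕ} (P : Fin N → Fin s → ℝ) : ℝ :=
  ((2 : ℝ) ^ (-(s * m : ℤ)) * ∑ T : Fin s → Fin (2 ^ m),
      ∫ Y in cube s, |Dloc (fun n => xorVec (P n) (Qpt m T)) Y| ^ p) ^ (1 / p)

/-- The standard normal distribution function `Φ`. -/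
def PhiCDF (w : ℝ) : ℝ :=
  (Real.sqrt (2 * Real.pi))⁻¹ * ∫ u in Set.Iio w, Real.exp (-u ^ 2 / 2)

/-- `χ_p`, the `p`-th absolute moment of the standard Gaussian. -/
def chiMoment (p : ℝ) : ℝ :=
  (Real.sqrt (2 * Real.pi))⁻¹ * ∫ u : ℝ, |u| ^ p * Real.exp (-u ^ 2 / 2)

/-- Digits `y_{n,i,j}` of the points of the dyadic digital sequence generated by
the `ℕ × ℕ` matrices `C` over `F_2`. -/
def seqDig (s : ℕ) (C : Fin s → ℕ → ℕ → ZMod 2) (n : ℕ) : Fin s → ℕ → ZMod 2 :=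
  fun i j => ∑ r ∈ Finset.range (n + 1), C i j r * (if n.testBit r then 1 else 0)

/-- The `n`-th point of the dyadic digital sequence generated by `C`. -/
def seqPoint (s : ℕ) (C : Fin s → ℕ → ℕ → ZMod 2) (n : ℕ) : Fin s → ℝ :=
  fun i => ∑' j : ℕ, ((seqDig s C n i j).val : ℝ) / 2 ^ (j + 1)

/-- The digital sequence generated by `C` is a dyadic digital `(T,s)`-sequence:
for all `m ≥ 1` and `k ≥ 0` the block `X_{k2^m}, …, X_{k2^m+2^m-1}` is a
`(T(m),m,s)`-net in base 2. -/
def IsTSeq (s : ℕ) (Tf : ℕ → ℕ) (C : Fin s → ℕ → ℕ → ZMod 2) : Prop :=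
  (∀ m, Tf m ≤ m) ∧
  ∀ m, 1 ≤ m → ∀ k : ℕ,
    IsNet (Tf m) m s fun n : Fin (2 ^ m) => seqPoint s C (k * 2 ^ m + (n : ℕ))

/-- The dual net `P_m^⊥` of the digital net generated by `C`. -/
def dualNet (m s : ℕ) (C : Fin s → Matrix (Fin m) (Fin m) (ZMod 2)) :
    Finset (Fin s → Fin m → ZMod 2) :=
  Finset.univ.filter fun mm => ∀ n : Fin (2 ^ m),
    (∑ i, ∑ j, mm i j * netDig m s C (n : ℕ) i j) = 0

/-- `ρ(b)`: the position of the last nonzero digit (`ρ(0) = 0`). -/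
def rhoF {m : ℕ} (b : Fin m → ZMod 2) : ℕ :=
  (Finset.univ.filter fun j => b j ≠ 0).sup fun j => (j : ℕ) + 1

/-- The 1-indexed component `𝔪_{i,a}` (as `0` or `1`), with the convention
`𝔪_{i,0} = 0`. -/
def mAt {m : ℕ} (b : Fin m → ZMod 2) (a : ℕ) : ℕ :=
  if h : 1 ≤ a ∧ a ≤ m then (b ⟨a - 1, by omega⟩).val else 0

/-- The 1-indexed digit of a digit array, with the convention that digit `0`
and digits beyond `m` are `0`. -/
def dAt {m : ℕ} (y : Fin m → Fin 2) (a : ℕ) : ℕ :=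
  if h : 1 ≤ a ∧ a ≤ m then (y ⟨a - 1, by omega⟩).val else 0

/-- `κ(A)`: the number of nonzero entries of `A`. -/
def kapF {s : ℕ} (A : Fin s → ℕ) : ℕ := (Finset.univ.filter fun i => A i ≠ 0).card

/-- `a₀(A) = a₁ + ⋯ + a_s`. -/
def a0F {s : ℕ} (A : Fin s → ℕ) : ℕ := ∑ i, A i

/-- `Λ_A(T ⊕ Y^{(m)})` as a function of the digit arrays `t`, `y` of `T`, `Y`:
`∑_{𝔪 ∈ P^{⊥,*}, ρ(𝔪_i) ≤ a_i} e(∑_i (∑_j 𝔪_{i,j}(t_{i,j}+y_{i,j}) + 𝔪_{i,a_i}))`,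
where `e(n) = exp(πin) = (-1)^n`. -/
def LamF (m s : ℕ) (C : Fin s → Matrix (Fin m) (Fin m) (ZMod 2)) (A : Fin s → ℕ)
    (t y : Fin s → Fin m → Fin 2) : ℝ :=
  ∑ mm ∈ (dualNet m s C).filter fun mm => mm ≠ 0 ∧ ∀ i, rhoF (mm i) ≤ A i,
    (-1 : ℝ) ^
      (∑ i, ((∑ j, (mm i j).val * ((t i j : ℕ) + (y i j : ℕ))) + mAt (mm i) (A i)))

/-- The Rademacher function `r_A(Y)` as a function of the digit array of `Y`. -/
def rademF {m s : ℕ} (A : Fin s → ℕ) (y : Fin s → Fin m → Fin 2) : ℝ :=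
  ∏ i, (-1 : ℝ) ^ dAt (y i) (A i)

/-- `Ψ_A = (-1)^{κ(A)} 2^{m-s-a₀(A)} r_A(Y) Λ_A(T ⊕ Y^{(m)})` at digit level. -/
def PsiF (m s : ℕ) (C : Fin s → Matrix (Fin m) (Fin m) (ZMod 2)) (A : Fin s → ℕ)
    (t y : Fin s → Fin m → Fin 2) : ℝ :=
  (-1 : ℝ) ^ kapF A * (2 : ℝ) ^ ((m : ℤ) - (s : ℤ) - (a0F A : ℤ)) *
    rademF A y * LamF m s C A t y

/-- `V₀ = 10 log₂ m`. -/
def V0 (m : ℕ) : ℝ := 10 * Real.logb 2 m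

/-- `I_{m,s,k} = {A ∈ I_m^s : max_i a_i = k, a₀(A) ∈ (m - t_m, m + V₀)}`. -/
def IndexSet (m s tm k : ℕ) : Finset (Fin s → ℕ) :=
  (Fintype.piFinset fun _ : Fin s => Finset.range (m + 1)).filter fun A =>
    Finset.univ.sup A = k ∧ ((m : ℝ) - tm < a0F A ∧ (a0F A : ℝ) < m + V0 m)

/-- `I_{m,s,m+1} = {A ∈ I_m^s : a₀(A) ≥ m + V₀}`. -/
def IndexTail (m s : ℕ) : Finset (Fin s → ℕ) :=
  (Fintype.piFinset fun _ : Fin s => Finset.range (m + 1)).filter fun A =>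
    (m : ℝ) + V0 m ≤ (a0F A : ℝ)

/-- `𝔇_k(T,Y) = ∑_{A ∈ I_{m,s,k}} Ψ_A` at digit level. -/
def DDk (m s tm : ℕ) (C : Fin s → Matrix (Fin m) (Fin m) (ZMod 2)) (k : ℕ)
    (t y : Fin s → Fin m → Fin 2) : ℝ :=
  ∑ A ∈ IndexSet m s tm k, PsiF m s C A t y

/-- `R(T,Y) = ∑_{A ∈ I_{m,s,m+1}} Ψ_A` at digit level. -/
def Rtail (m s : ℕ) (C : Fin s → Matrix (Fin m) (Fin m) (ZMod 2))
    (t y : Fin s → Fin m → Fin 2) : ℝ :=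
  ∑ A ∈ IndexTail m s, PsiF m s C A t y

/-- `E^{(m)}_{Y,T}(f)`: the average of `f` over all digit arrays. -/
def Em (m s : ℕ) (f : (Fin s → Fin m → Fin 2) → (Fin s → Fin m → Fin 2) → ℝ) : ℝ :=
  (2 : ℝ) ^ (-(2 * s * m : ℤ)) *
    ∑ t : Fin s → Fin m → Fin 2, ∑ y : Fin s → Fin m → Fin 2, f t y

/-- Keep the first `k` digits of `t`, replace the remaining ones by those of `t'`. -/
def mergeDig {m s : ℕ} (k : ℕ) (t t' : Fin s → Fin m → Fin 2) :
    Fin s → Fin m → Fin 2 :=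
  fun i j => if (j : ℕ) < k then t i j else t' i j

/-- The conditional expectation `E^{(m)}_{Y,T}(f | F_k)` with respect to the
σ-field `F_k` generated by the dyadic cubes of side `2^{-k}`: the average of `f`
over the digits of index `> k`, as a function of the digit arrays `t`, `y`. -/
def EmCond (m s k : ℕ)
    (f : (Fin s → Fin m → Fin 2) → (Fin s → Fin m → Fin 2) → ℝ)
    (t y : Fin s → Fin m → Fin 2) : ℝ :=
  (2 : ℝ) ^ (-(2 * s * m : ℤ)) *
    ∑ t' : Fin s → Fin m → Fin 2, ∑ y' : Fin s → Fin m → Fin 2,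
      f (mergeDig k t t') (mergeDig k y y')

/-- `Θ_{A₁,A₂,k} = E^{(m)}_{Y,T}(Ψ_{A₁}Ψ_{A₂} | F_{k-1}) - E^{(m)}_{Y,T}(Ψ_{A₁}Ψ_{A₂})`. -/
def ThetaF (m s : ℕ) (C : Fin s → Matrix (Fin m) (Fin m) (ZMod 2))
    (A1 A2 : Fin s → ℕ) (k : ℕ) (t y : Fin s → Fin m → Fin 2) : ℝ :=
  EmCond m s (k - 1) (fun t' y' => PsiF m s C A1 t' y' * PsiF m s C A2 t' y') t y -
    Em m s fun t' y' => PsiF m s C A1 t' y' * PsiF m s C A2 t' y'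

/-- `Υ_{d₁,d₂,d₃,J,k}` for a partition `J = (J₁,J₂,J₃)` of `{1,…,s}` and
`k = (k₁,k₂)`. -/
def Ups (m s tm : ℕ) (C : Fin s → Matrix (Fin m) (Fin m) (ZMod 2))
    (J1 J2 J3 : Finset (Fin s)) (k1 k2 : ℕ) : ℝ :=
  ∑ A1 ∈ IndexSet m s tm k1, ∑ A2 ∈ IndexSet m s tm k1,
    ∑ A3 ∈ IndexSet m s tm k2, ∑ A4 ∈ IndexSet m s tm k2,
      (Em m s fun t y => ThetaF m s C A1 A2 k1 t y * ThetaF m s C A3 A4 k2 t y) *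
        (if (Finset.univ.filter fun i => A1 i = A2 i) = J1 ∧
            (Finset.univ.filter fun i => A1 i < A2 i) = J2 ∧
            (Finset.univ.filter fun i => A2 i < A1 i) = J3 ∧
            (Finset.univ.filter fun i => A3 i = A4 i) = J1 ∧
            (Finset.univ.filter fun i => A3 i < A4 i) = J2 ∧
            (Finset.univ.filter fun i => A4 i < A3 i) = J3 then (1 : ℝ) else 0)

/-- The array of the first `m` dyadic digits of the coordinates of `Y`. -/
def digitsOf (m s : ℕ) (Y : Fin s → ℝ) : Fin s → Fin m → Fin 2 :=
  fun i j => ⟨bdigit ((j : ℕ) + 1) (Y i), by unfold bdigit; omega⟩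

/-- Truncation `y^{(m)}` to the first `m` dyadic digits. -/
def truncR (m : ℕ) (y : ℝ) : ℝ :=
  ∑ j ∈ Finset.range m, (bdigit (j + 1) y : ℝ) / 2 ^ (j + 1)

/-- The elementary interval `Π_a` (`Π_0 = [0,1)`, `Π_a = [2^{-a}, 2^{1-a})`). -/
def PiBox (a : ℕ) : Set ℝ :=
  if a = 0 then Set.Ico 0 1 else Set.Ico ((2 : ℝ) ^ (-(a : ℤ))) ((2 : ℝ) ^ (1 - (a : ℤ)))

/-- `λ_A(Y) = 1_{Π_A}(Y) - vol(Π_A)`. -/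
def lamA {s : ℕ} (A : Fin s → ℕ) (Y : Fin s → ℝ) : ℝ :=
  (if ∀ i, Y i ∈ PiBox (A i) then (1 : ℝ) else 0) - (2 : ℝ) ^ (-(a0F A : ℤ))

/-- The micro-local discrepancy `λ_A(P_m^{(m)} ⊕ T ⊕ Y^{(m)})`. -/
def lamNet (m s : ℕ) (C : Fin s → Matrix (Fin m) (Fin m) (ZMod 2))
    (T Y : Fin s → ℝ) (A : Fin s → ℕ) : ℝ :=
  ∑ n : Fin (2 ^ m),
    lamA A fun i =>
      xorReal (xorReal (truncR m (netPoint m s C (n : ℕ) i)) (T i)) (truncR m (Y i))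

/-- The Rademacher function `r_A(Y)` for a real point `Y`. -/
def rademReal {s : ℕ} (A : Fin s → ℕ) (Y : Fin s → ℝ) : ℝ :=
  ∏ i, if A i = 0 then (1 : ℝ) else 1 - 2 * (bdigit (A i) (Y i) : ℝ)

/-- The truncated discrepancy
`D^{(m)}(P_m ⊕ T, Y) = 2^{-s} ∑_{A ∈ I_m^s} (-1)^{κ(A)} λ_A(P_m^{(m)} ⊕ T ⊕ Y^{(m)}) r_A(Y)`. -/
def Dm (m s : ℕ) (C : Fin s → Matrix (Fin m) (Fin m) (ZMod 2)) (T Y : Fin s → ℝ) : ℝ :=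
  (2 : ℝ) ^ (-(s : ℤ)) *
    ∑ A ∈ Fintype.piFinset fun _ : Fin s => Finset.range (m + 1),
      (-1 : ℝ) ^ kapF A * lamNet m s C T Y A * rademReal A Y

/-- `𝔼_{Y,T,m}(f) = 2^{-sm} ∑_{T ∈ Q^s(2^m)} ∫_{[0,1]^s} f(T,Y) dY`. -/
def EE (m s : ℕ) (f : (Fin s → ℝ) → (Fin s → ℝ) → ℝ) : ℝ :=
  (2 : ℝ) ^ (-(s * m : ℤ)) * ∑ T : Fin s → Fin (2 ^ m), ∫ Y in cube s, f (Qpt m T) Y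
open scoped BigOperators

lemma abs_cos_sub_exp_le (x : ℝ) : |Real.cos x - Real.exp (-(x ^ 2 / 2))| ≤ 2 * x ^ 4 := by
  by_cases hx : |x| ≤ 1
  · have h1 := Real.cos_bound hx
    have hx2 : x ^ 2 ≤ 1 := by
      rw [← sq_abs]; nlinarith [abs_nonneg x]
    have h2 := Real.abs_exp_sub_one_sub_id_le (x := -(x ^ 2 / 2)) (by
      rw [abs_neg, abs_of_nonneg (by positivity)]; linarith)
    have h4 : |x| ^ 4 = x ^ 4 := by
      rw [show (4 : ℕ) = 2 * 2 by norm_num, pow_mul, sq_abs, ← pow_mul]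
    rw [h4] at h1
    rw [abs_le] at *
    have h5 : 0 ≤ x ^ 4 := by positivity
    have h6 : (-(x ^ 2 / 2)) ^ 2 = x ^ 4 / 4 := by ring
    rw [h6] at h2
    constructor <;> linarith [h1.1, h1.2, h2.1, h2.2]
  · have hx' : 1 ≤ |x| := (not_le.mp hx).le
    have hx2 : 1 ≤ x ^ 2 := by
      rw [← sq_abs]; nlinarith
    have hx4 : 1 ≤ x ^ 4 := by nlinarith
    have h3 : Real.exp (-(x ^ 2 / 2)) ≤ 1 := Real.exp_le_one_iff.mpr (by linarith)
    have h4 := Real.exp_pos (-(x ^ 2 / 2))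
    rw [abs_le]
    constructor <;> linarith [Real.cos_le_one x, Real.neg_one_le_cos x]

lemma abs_prod_sub_prod_le_sum {ι : Type*} (S : Finset ι) (a b : ι → ℝ)
    (ha : ∀ i, |a i| ≤ 1) (hb : ∀ i, |b i| ≤ 1) :
    |∏ i ∈ S, a i - ∏ i ∈ S, b i| ≤ ∑ i ∈ S, |a i - b i| := by
  induction S using Finset.induction_on with
  | empty => simp
  | insert i S hi ih =>
    rw [Finset.prod_insert hi, Finset.prod_insert hi, Finset.sum_insert hi]
    have hP : |∏ i ∈ S, b i| ≤ 1 := by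
      rw [Finset.abs_prod]
      exact Finset.prod_le_one (fun _ _ => abs_nonneg _) fun i _ => hb i
    calc |a i * ∏ i ∈ S, a i - b i * ∏ i ∈ S, b i|
        = |a i * (∏ i ∈ S, a i - ∏ i ∈ S, b i) + (a i - b i) * ∏ i ∈ S, b i| := by ring_nf
      _ ≤ |a i| * |∏ i ∈ S, a i - ∏ i ∈ S, b i| + |a i - b i| * |∏ i ∈ S, b i| := by
          rw [← abs_mul, ← abs_mul]; exact abs_add_le _ _
      _ ≤ 1 * |∏ i ∈ S, a i - ∏ i ∈ S, b i| + |a i - b i| * 1 := by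
          gcongr
          exact ha i
      _ ≤ _ := by linarith

lemma abs_exp_neg_sub_exp_neg_le {u v : ℝ} (hu : 0 ≤ u) (hv : 0 ≤ v) :
    |Real.exp (-u) - Real.exp (-v)| ≤ |u - v| := by
  wlog h : u ≤ v generalizing u v
  · rw [abs_sub_comm, abs_sub_comm u v]
    exact this hv hu (not_le.mp h).le
  have h1 : Real.exp (-v) ≤ Real.exp (-u) := Real.exp_le_exp.mpr (by linarith)
  rw [abs_of_nonneg (by linarith), abs_of_nonpos (by linarith)]
  have h2 : Real.exp (-v) = Real.exp (-u) * Real.exp (-(v - u)) := by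
    rw [← Real.exp_add]; ring_nf
  have h3 := Real.add_one_le_exp (-(v - u))
  have h4 : Real.exp (-u) ≤ 1 := Real.exp_le_one_iff.mpr (by linarith)
  have h5 : Real.exp (-(v - u)) ≤ 1 := Real.exp_le_one_iff.mpr (by linarith)
  rw [h2]
  nlinarith [Real.exp_pos (-u)]

/-- Averaging over random signs turns the exponential into a product of cosines. -/
lemma expect_signs_exp {m : ℕ} (u : Fin m → ℝ) :
    𝔼 ε : Fin m → Fin 2, Complex.exp (Complex.I * ((∑ j, (-1 : ℝ) ^ (ε j).val * u j : ℝ) : ℂ)) =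
      ((∏ j, Real.cos (u j) : ℝ) : ℂ) := by
  have h : ∀ ε : Fin m → Fin 2,
      Complex.exp (Complex.I * ((∑ j, (-1 : ℝ) ^ (ε j).val * u j : ℝ) : ℂ)) =
        ∏ j, Complex.exp (Complex.I * (((-1 : ℝ) ^ (ε j).val * u j : ℝ) : ℂ)) := by
    intro ε
    rw [← Complex.exp_sum]
    push_cast
    rw [Finset.mul_sum]
  simp_rw [h]
  rw [Fintype.expect_eq_sum_div_card,
    ← Fintype.prod_sum (fun j (e : Fin 2) => Complex.exp (Complex.I * (((-1 : ℝ) ^ e.val * u j : ℝ) : ℂ)))]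
  have h2 : ∀ j, ∑ e : Fin 2, Complex.exp (Complex.I * (((-1 : ℝ) ^ e.val * u j : ℝ) : ℂ)) =
      2 * ((Real.cos (u j) : ℝ) : ℂ) := by
    intro j
    rw [Fin.sum_univ_two, Complex.ofReal_cos, Complex.cos]
    push_cast
    simp only [Fin.val_zero, Fin.val_one, pow_zero, pow_one, one_mul]
    rw [show Complex.I * (u j : ℂ) = (u j : ℂ) * Complex.I by ring,
      show Complex.I * (-1 * (u j : ℂ)) = -(u j : ℂ) * Complex.I by ring]
    ring
  simp_rw [h2, Finset.prod_mul_distrib]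
  simp

/-- If flipping signs of the `W j` can be realised by permutations of the probability space, the
characteristic function of `W0 + ∑ W j` is close to a Gaussian one. -/
lemma norm_expect_exp_sub_gaussian_le {Ω : Type*} [Fintype Ω] [Nonempty Ω] {m : ℕ} (W0 : Ω → ℝ)
    (W : Fin m → Ω → ℝ) (σ : (Fin m → Fin 2) → Equiv.Perm Ω)
    (h0 : ∀ ε ω, W0 (σ ε ω) = W0 ω)
    (h1 : ∀ ε j ω, W j (σ ε ω) = (-1) ^ (ε j).val * W j ω) (τ : ℝ) :
    ‖𝔼 ω, Complex.exp (Complex.I * ((W0 ω + ∑ j, W j ω : ℝ) : ℂ)) -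
        ((Real.exp (-(τ ^ 2 / 2)) : ℝ) : ℂ)‖ ≤
      𝔼 ω, |W0 ω| + 2 * 𝔼 ω, ∑ j, W j ω ^ 4 + 1 / 2 * 𝔼 ω, |∑ j, W j ω ^ 2 - τ ^ 2| := by
  have key : 𝔼 ω, Complex.exp (Complex.I * ((W0 ω + ∑ j, W j ω : ℝ) : ℂ)) =
      𝔼 ω, Complex.exp (Complex.I * (W0 ω : ℂ)) * ((∏ j, Real.cos (W j ω) : ℝ) : ℂ) := by
    calc 𝔼 ω, Complex.exp (Complex.I * ((W0 ω + ∑ j, W j ω : ℝ) : ℂ))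
        = 𝔼 ε : Fin m → Fin 2, 𝔼 ω, Complex.exp (Complex.I * ((W0 ω + ∑ j, W j ω : ℝ) : ℂ)) := by
          rw [Fintype.expect_const]
      _ = 𝔼 ε : Fin m → Fin 2, 𝔼 ω, Complex.exp (Complex.I * (W0 ω : ℂ)) *
            Complex.exp (Complex.I * ((∑ j, (-1 : ℝ) ^ (ε j).val * W j ω : ℝ) : ℂ)) := by
          refine Finset.expect_congr rfl fun ε _ => ?_
          refine (Fintype.expect_equiv (σ ε) _ _ fun ω => ?_).symm
          rw [h0, ← Complex.exp_add]
          simp_rw [h1]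
          push_cast
          ring_nf
      _ = _ := by
          rw [Finset.expect_comm]
          refine Finset.expect_congr rfl fun ω _ => ?_
          rw [← Finset.mul_expect, expect_signs_exp]
  rw [key, ← Fintype.expect_const (ι := Ω) ((Real.exp (-(τ ^ 2 / 2)) : ℝ) : ℂ),
    ← Finset.expect_sub_distrib, Finset.mul_expect, Finset.mul_expect,
    ← Finset.expect_add_distrib, ← Finset.expect_add_distrib]
  refine (RCLike.norm_expect_le (K := ℝ)).trans (Finset.expect_le_expect fun ω _ => ?_)
  set P : ℝ := ∏ j, Real.cos (W j ω) with hP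
  have hP1 : |P| ≤ 1 := by
    rw [hP, Finset.abs_prod]
    exact Finset.prod_le_one (fun _ _ => abs_nonneg _) fun i _ => Real.abs_cos_le_one _
  have hG : ∏ j, Real.exp (-(W j ω ^ 2 / 2)) = Real.exp (-((∑ j, W j ω ^ 2) / 2)) := by
    rw [← Real.exp_sum, Finset.sum_neg_distrib, Finset.sum_div]
  have e1 : |P - Real.exp (-((∑ j, W j ω ^ 2) / 2))| ≤ 2 * ∑ j, W j ω ^ 4 := by
    rw [← hG, Finset.mul_sum]
    refine (abs_prod_sub_prod_le_sum _ _ _ (fun i => Real.abs_cos_le_one _) fun i => ?_).trans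
      (Finset.sum_le_sum fun j _ => abs_cos_sub_exp_le _)
    rw [abs_of_pos (Real.exp_pos _)]
    exact Real.exp_le_one_iff.mpr (by linarith [sq_nonneg (W i ω)])
  have e2 : |Real.exp (-((∑ j, W j ω ^ 2) / 2)) - Real.exp (-(τ ^ 2 / 2))| ≤
      1 / 2 * |∑ j, W j ω ^ 2 - τ ^ 2| := by
    refine (abs_exp_neg_sub_exp_neg_le (by positivity) (by positivity)).trans (le_of_eq ?_)
    rw [← sub_div, abs_div, abs_two]
    ring
  have e3 : ‖Complex.exp (Complex.I * (W0 ω : ℂ)) * (P : ℂ) - (P : ℂ)‖ ≤ |W0 ω| := by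
    rw [show Complex.exp (Complex.I * (W0 ω : ℂ)) * (P : ℂ) - (P : ℂ) =
      (Complex.exp (Complex.I * (W0 ω : ℂ)) - 1) * (P : ℂ) by ring, norm_mul]
    have := Real.norm_exp_I_mul_ofReal_sub_one_le (x := W0 ω)
    rw [Complex.norm_real, Real.norm_eq_abs]
    rw [Real.norm_eq_abs] at this
    nlinarith [abs_nonneg P, norm_nonneg (Complex.exp (Complex.I * (W0 ω : ℂ)) - 1)]
  calc ‖Complex.exp (Complex.I * (W0 ω : ℂ)) * (P : ℂ) - ((Real.exp (-(τ ^ 2 / 2)) : ℝ) : ℂ)‖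
      = ‖(Complex.exp (Complex.I * (W0 ω : ℂ)) * (P : ℂ) - (P : ℂ)) +
          (((P - Real.exp (-((∑ j, W j ω ^ 2) / 2))) +
           (Real.exp (-((∑ j, W j ω ^ 2) / 2)) - Real.exp (-(τ ^ 2 / 2))) : ℝ) : ℂ)‖ := by
        congr 1; push_cast; ring
    _ ≤ |W0 ω| + (|P - Real.exp (-((∑ j, W j ω ^ 2) / 2))| +
          |Real.exp (-((∑ j, W j ω ^ 2) / 2)) - Real.exp (-(τ ^ 2 / 2))|) := by
        refine (norm_add_le _ _).trans (add_le_add e3 ?_)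
        rw [Complex.norm_real, Real.norm_eq_abs]
        exact abs_add_le _ _
    _ ≤ _ := by linarith

/-- The four indices cancel in pairs. -/
def Paired (a b c d : ℕ) : Prop := (a = b ∧ c = d) ∨ (a = c ∧ b = d) ∨ (a = d ∧ b = c)

lemma exists_odd_index {a b c d : ℕ} (h : ¬ Paired a b c d) :
    ∃ p, p ≠ 0 ∧ (p = a ∨ p = b ∨ p = c ∨ p = d) ∧
      (if a = p then (-1 : ℝ) else 1) * (if b = p then (-1 : ℝ) else 1) *
        (if c = p then (-1 : ℝ) else 1) * (if d = p then (-1 : ℝ) else 1) = -1 := by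
  unfold Paired at h
  by_contra! H
  have ha := H a
  have hb := H b
  have hc := H c
  have hd := H d
  by_cases h1 : a = b <;> by_cases h2 : a = c <;> by_cases h3 : a = d <;>
    by_cases h4 : b = c <;> by_cases h5 : b = d <;> by_cases h6 : c = d <;>
    simp_all [eq_comm]

lemma neg_one_pow_fin_two_add (a b : Fin 2) :
    (-1 : ℝ) ^ (a + b).val = (-1) ^ a.val * (-1) ^ b.val := by
  fin_cases a <;> fin_cases b <;> simp

lemma neg_one_pow_dAt_add_single {m : ℕ} (ε : Fin m → Fin 2) (p : Fin m) (a : ℕ) :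
    (-1 : ℝ) ^ dAt (ε + Pi.single p 1) a =
      (if a = p.val + 1 then (-1 : ℝ) else 1) * (-1) ^ dAt ε a := by
  unfold dAt
  by_cases h : 1 ≤ a ∧ a ≤ m
  · rw [dif_pos h, dif_pos h, Pi.add_apply, neg_one_pow_fin_two_add, mul_comm]
    congr 1
    by_cases hp : a = p.val + 1
    · have : (⟨a - 1, by omega⟩ : Fin m) = p := Fin.ext (by simp [hp])
      rw [this, if_pos hp]
      simp
    · have : (⟨a - 1, by omega⟩ : Fin m) ≠ p := fun hh => hp (by rw [← hh]; simp; omega)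
      rw [if_neg hp, Pi.single_eq_of_ne this]
      simp
  · rw [dif_neg h, dif_neg h, if_neg (by have := p.isLt; omega)]
    simp

lemma sum_sign_four_eq_zero {m a b c d : ℕ} (ha : a ≤ m) (hb : b ≤ m) (hc : c ≤ m) (hd : d ≤ m)
    (h : ¬ Paired a b c d) :
    ∑ ε : Fin m → Fin 2,
      (-1 : ℝ) ^ dAt ε a * (-1) ^ dAt ε b * (-1) ^ dAt ε c * (-1) ^ dAt ε d = 0 := by
  obtain ⟨p, hp0, hp, hodd⟩ := exists_odd_index h
  have hpm : p - 1 < m := by omega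
  set q : Fin m := ⟨p - 1, hpm⟩
  have hq : q.val + 1 = p := by simp [q]; omega
  have key : ∑ ε : Fin m → Fin 2,
      (-1 : ℝ) ^ dAt ε a * (-1) ^ dAt ε b * (-1) ^ dAt ε c * (-1) ^ dAt ε d =
      ∑ ε : Fin m → Fin 2,
      -((-1 : ℝ) ^ dAt ε a * (-1) ^ dAt ε b * (-1) ^ dAt ε c * (-1) ^ dAt ε d) := by
    rw [← Equiv.sum_comp (Equiv.addRight (Pi.single q (1 : Fin 2) : Fin m → Fin 2))]
    refine Finset.sum_congr rfl fun ε _ => ?_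
    simp only [Equiv.coe_addRight, neg_one_pow_dAt_add_single, hq]
    linear_combination ((-1 : ℝ) ^ dAt ε a * (-1) ^ dAt ε b * (-1) ^ dAt ε c * (-1) ^ dAt ε d) * hodd
  rw [Finset.sum_neg_distrib] at key
  linarith

lemma expect_radem_four_eq_zero {m s : ℕ} {A B C D : Fin s → ℕ} (hA : ∀ i, A i ≤ m)
    (hB : ∀ i, B i ≤ m) (hC : ∀ i, C i ≤ m) (hD : ∀ i, D i ≤ m)
    (h : ¬ ∀ i, Paired (A i) (B i) (C i) (D i)) :
    𝔼 y : Fin s → Fin m → Fin 2, rademF A y * rademF B y * rademF C y * rademF D y = 0 := by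
  rw [Fintype.expect_eq_sum_div_card]
  push Not at h
  obtain ⟨i, hi⟩ := h
  simp only [rademF, ← Finset.prod_mul_distrib]
  rw [← Fintype.prod_sum (fun i (ε : Fin m → Fin 2) =>
    (-1 : ℝ) ^ dAt ε (A i) * (-1) ^ dAt ε (B i) * (-1) ^ dAt ε (C i) * (-1) ^ dAt ε (D i)),
    Finset.prod_eq_zero (Finset.mem_univ i), zero_div]
  exact sum_sign_four_eq_zero (hA i) (hB i) (hC i) (hD i) hi

lemma rademF_mul_self {m s : ℕ} (A : Fin s → ℕ) (y : Fin s → Fin m → Fin 2) :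
    rademF A y * rademF A y = 1 := by
  simp only [rademF, ← Finset.prod_mul_distrib]
  exact Finset.prod_eq_one fun i _ => by rw [← mul_pow]; simp

lemma abs_rademF {m s : ℕ} (A : Fin s → ℕ) (y : Fin s → Fin m → Fin 2) : |rademF A y| = 1 := by
  simp [rademF, Finset.abs_prod]

lemma expect_radem_two_eq_zero {m s : ℕ} {A B : Fin s → ℕ} (hA : ∀ i, A i ≤ m)
    (hB : ∀ i, B i ≤ m) (h : A ≠ B) :
    𝔼 y : Fin s → Fin m → Fin 2, rademF A y * rademF B y = 0 := by
  have := expect_radem_four_eq_zero hA hB hA hA (fun H => h (funext fun i => by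
    rcases H i with h | h | h <;> simp_all))
  simpa only [mul_assoc, rademF_mul_self, mul_one] using this

/-- The Walsh character of the digit space attached to `x`. -/
def walsh {m s : ℕ} (x : Fin s → Fin m → ZMod 2) (z : Fin s → Fin m → Fin 2) : ℝ :=
  ∏ i, ∏ j, (-1 : ℝ) ^ ((x i j).val * (z i j).val)

lemma neg_one_pow_zmod_two_add (a b : ZMod 2) (c : ℕ) :
    (-1 : ℝ) ^ ((a + b).val * c) = (-1) ^ (a.val * c) * (-1) ^ (b.val * c) := by
  rw [pow_mul, pow_mul, pow_mul, ← mul_pow]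
  congr 1
  exact neg_one_pow_fin_two_add a b

lemma walsh_add {m s : ℕ} (x y : Fin s → Fin m → ZMod 2) (z : Fin s → Fin m → Fin 2) :
    walsh (x + y) z = walsh x z * walsh y z := by
  simp only [walsh, ← Finset.prod_mul_distrib, Pi.add_apply, neg_one_pow_zmod_two_add]

lemma abs_walsh {m s : ℕ} (x : Fin s → Fin m → ZMod 2) (z : Fin s → Fin m → Fin 2) :
    |walsh x z| = 1 := by
  simp [walsh, Finset.abs_prod]

lemma expect_walsh {m s : ℕ} (x : Fin s → Fin m → ZMod 2) :
    𝔼 z : Fin s → Fin m → Fin 2, walsh x z = if x = 0 then 1 else 0 := by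
  split_ifs with hx
  · subst hx
    simp [walsh]
  · have : ∃ i j, x i j ≠ 0 := by
      by_contra! H
      exact hx (funext fun i => funext fun j => H i j)
    obtain ⟨i, j, hij⟩ := this
    rw [Fintype.expect_eq_sum_div_card]
    unfold walsh
    rw [← Fintype.prod_sum (fun i (ε : Fin m → Fin 2) => ∏ j, (-1 : ℝ) ^ ((x i j).val * (ε j).val)),
      Finset.prod_eq_zero (Finset.mem_univ i), zero_div]
    rw [← Fintype.prod_sum (fun j (e : Fin 2) => (-1 : ℝ) ^ ((x i j).val * e.val)),
      Finset.prod_eq_zero (Finset.mem_univ j)]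
    have h1 : (x i j).val = 1 := by
      generalize x i j = v at hij
      revert hij
      revert v
      decide
    simp [h1]

/-- The index set of the sum defining `Λ_A`. -/
def dualBox (m s : ℕ) (C : Fin s → Matrix (Fin m) (Fin m) (ZMod 2)) (A : Fin s → ℕ) :
    Finset (Fin s → Fin m → ZMod 2) :=
  (dualNet m s C).filter fun mm => mm ≠ 0 ∧ ∀ i, rhoF (mm i) ≤ A i

/-- The sign with which the character of `mm` enters `Λ_A`. -/
def boxSign {m s : ℕ} (A : Fin s → ℕ) (mm : Fin s → Fin m → ZMod 2) : ℝ :=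
  (-1) ^ ∑ i, mAt (mm i) (A i)

lemma boxSign_mul_self {m s : ℕ} (A : Fin s → ℕ) (mm : Fin s → Fin m → ZMod 2) :
    boxSign A mm * boxSign A mm = 1 := by
  rw [boxSign, ← mul_pow]; simp

lemma abs_boxSign {m s : ℕ} (A : Fin s → ℕ) (mm : Fin s → Fin m → ZMod 2) :
    |boxSign A mm| = 1 := by
  simp [boxSign]

/-- `Λ_A` as a function of the sum of the two digit arrays. -/
def LamZ (m s : ℕ) (C : Fin s → Matrix (Fin m) (Fin m) (ZMod 2)) (A : Fin s → ℕ)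
    (z : Fin s → Fin m → Fin 2) : ℝ :=
  ∑ mm ∈ dualBox m s C A, boxSign A mm * walsh mm z

lemma LamF_eq_LamZ (m s : ℕ) (C : Fin s → Matrix (Fin m) (Fin m) (ZMod 2)) (A : Fin s → ℕ)
    (t y : Fin s → Fin m → Fin 2) : LamF m s C A t y = LamZ m s C A (t + y) := by
  unfold LamF LamZ
  refine Finset.sum_congr rfl fun mm _ => ?_
  rw [Finset.sum_add_distrib, pow_add, mul_comm, boxSign, walsh]
  congr 1
  rw [← Finset.prod_pow_eq_pow_sum]
  refine Finset.prod_congr rfl fun i _ => ?_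
  rw [← Finset.prod_pow_eq_pow_sum]
  refine Finset.prod_congr rfl fun j _ => ?_
  rw [mul_comm, pow_mul, mul_comm _ ((t + y) i j).val, pow_mul, pow_add, Pi.add_apply, Pi.add_apply,
    neg_one_pow_fin_two_add]

lemma abs_LamZ_le (m s : ℕ) (C : Fin s → Matrix (Fin m) (Fin m) (ZMod 2)) (A : Fin s → ℕ)
    (z : Fin s → Fin m → Fin 2) : |LamZ m s C A z| ≤ (dualBox m s C A).card := by
  unfold LamZ
  refine (Finset.abs_sum_le_sum_abs _ _).trans ?_
  simp [abs_mul, abs_boxSign, abs_walsh]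

lemma zmod_two_pi_add_eq_zero {m s : ℕ} (x y : Fin s → Fin m → ZMod 2) : x + y = 0 ↔ x = y := by
  constructor
  · intro h
    funext i j
    have := congrFun (congrFun h i) j
    simp only [Pi.add_apply, Pi.zero_apply] at this
    generalize x i j = a at *
    generalize y i j = b at *
    revert a b
    decide
  · rintro rfl
    funext i j
    simp only [Pi.add_apply, Pi.zero_apply]
    exact CharTwo.add_self_eq_zero _

lemma LamZ_sq (m s : ℕ) (C : Fin s → Matrix (Fin m) (Fin m) (ZMod 2)) (A : Fin s → ℕ)
    (z : Fin s → Fin m → Fin 2) : LamZ m s C A z ^ 2 =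
      ∑ p ∈ dualBox m s C A ×ˢ dualBox m s C A,
        boxSign A p.1 * boxSign A p.2 * walsh (p.1 + p.2) z := by
  rw [sq, LamZ, Finset.sum_mul_sum, Finset.sum_product]
  refine Finset.sum_congr rfl fun x _ => Finset.sum_congr rfl fun y _ => ?_
  rw [walsh_add]; ring

lemma expect_LamZ_sq (m s : ℕ) (C : Fin s → Matrix (Fin m) (Fin m) (ZMod 2)) (A : Fin s → ℕ) :
    𝔼 z, LamZ m s C A z ^ 2 = (dualBox m s C A).card := by
  simp_rw [LamZ_sq]
  rw [Finset.expect_sum_comm]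
  simp_rw [← Finset.mul_expect, expect_walsh, zmod_two_pi_add_eq_zero]
  rw [Finset.sum_product]
  simp only [mul_ite, mul_one, mul_zero, Finset.sum_ite_eq]
  rw [Finset.sum_congr rfl (g := fun _ => (1 : ℝ))]
  · simp
  · intro x hx
    rw [if_pos hx, boxSign_mul_self]

lemma rhoF_le_iff {m : ℕ} (b : Fin m → ZMod 2) (a : ℕ) :
    rhoF b ≤ a ↔ ∀ j : Fin m, a ≤ j.val → b j = 0 := by
  unfold rhoF
  rw [Finset.sup_le_iff]
  constructor
  · intro h j hj
    by_contra hb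
    have := h j (by simp [hb])
    omega
  · intro h j hj
    by_contra hh
    simp only [Finset.mem_filter, Finset.mem_univ, true_and] at hj
    exact hj (h j (by omega))

lemma dualNet_add {m s : ℕ} {C : Fin s → Matrix (Fin m) (Fin m) (ZMod 2)}
    {x y : Fin s → Fin m → ZMod 2} (hx : x ∈ dualNet m s C) (hy : y ∈ dualNet m s C) :
    x + y ∈ dualNet m s C := by
  simp only [dualNet, Finset.mem_filter, Finset.mem_univ, true_and] at *
  intro n
  simp only [Pi.add_apply, add_mul, Finset.sum_add_distrib, hx n, hy n, add_zero]

lemma dualBox_add {m s : ℕ} {C : Fin s → Matrix (Fin m) (Fin m) (ZMod 2)} {A : Fin s → ℕ}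
    {x y : Fin s → Fin m → ZMod 2} (hx : x ∈ dualBox m s C A) (hy : y ∈ dualBox m s C A)
    (hxy : x ≠ y) : x + y ∈ dualBox m s C A := by
  simp only [dualBox, Finset.mem_filter, rhoF_le_iff] at *
  refine ⟨dualNet_add hx.1 hy.1, fun h => hxy ((zmod_two_pi_add_eq_zero x y).mp h), fun i j hj => ?_⟩
  simp [hx.2.2 i j hj, hy.2.2 i j hj]

lemma dualBox_inf {m s : ℕ} {C : Fin s → Matrix (Fin m) (Fin m) (ZMod 2)} {A B : Fin s → ℕ}
    {x : Fin s → Fin m → ZMod 2} (hx : x ∈ dualBox m s C A) (hy : x ∈ dualBox m s C B) :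
    x ∈ dualBox m s C (A ⊓ B) := by
  simp only [dualBox, Finset.mem_filter] at *
  exact ⟨hx.1, hx.2.1, fun i => le_inf (hx.2.2 i) (hy.2.2 i)⟩

lemma expect_LamZ_sq_mul {m s : ℕ} {C : Fin s → Matrix (Fin m) (Fin m) (ZMod 2)} {A B : Fin s → ℕ}
    (h : dualBox m s C (A ⊓ B) = ∅) :
    𝔼 z, LamZ m s C A z ^ 2 * LamZ m s C B z ^ 2 =
      (𝔼 z, LamZ m s C A z ^ 2) * 𝔼 z, LamZ m s C B z ^ 2 := by
  simp_rw [LamZ_sq, Finset.sum_mul_sum, Finset.expect_sum_comm]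
  rw [Finset.sum_mul_sum]
  refine Finset.sum_congr rfl fun p hp => Finset.sum_congr rfl fun q hq => ?_
  rw [Finset.mem_product] at hp hq
  rw [← Finset.mul_expect, ← Finset.mul_expect, expect_walsh, expect_walsh]
  have : ∀ z : Fin s → Fin m → Fin 2, boxSign A p.1 * boxSign A p.2 * walsh (p.1 + p.2) z *
      (boxSign B q.1 * boxSign B q.2 * walsh (q.1 + q.2) z) =
      (boxSign A p.1 * boxSign A p.2) * (boxSign B q.1 * boxSign B q.2) *
        walsh ((p.1 + p.2) + (q.1 + q.2)) z := by
    intro z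
    rw [walsh_add (p.1 + p.2)]; ring
  simp_rw [this]
  rw [← Finset.mul_expect, expect_walsh]
  simp_rw [zmod_two_pi_add_eq_zero]
  by_cases h1 : p.1 = p.2 <;> by_cases h2 : q.1 = q.2
  · rw [if_pos, if_pos h1, if_pos h2]
    · ring
    · rw [(zmod_two_pi_add_eq_zero _ _).mpr h1, (zmod_two_pi_add_eq_zero _ _).mpr h2]
  · rw [if_neg, if_neg h2]
    · ring
    · rw [(zmod_two_pi_add_eq_zero _ _).mpr h1]
      exact fun h => h2 ((zmod_two_pi_add_eq_zero _ _).mp h.symm)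
  · rw [if_neg, if_neg h1]
    · ring
    · rw [(zmod_two_pi_add_eq_zero _ _).mpr h2]
      exact fun h => h1 ((zmod_two_pi_add_eq_zero _ _).mp h)
  · rw [if_neg, if_neg h1]
    · ring
    · intro h3
      have hA := dualBox_add hp.1 hp.2 h1
      have hB := dualBox_add hq.1 hq.2 h2
      rw [← h3] at hB
      have := dualBox_inf hA hB
      rw [h] at this
      exact absurd this (Finset.notMem_empty _)

lemma zmod_two_val_eq_one {v : ZMod 2} (h : v ≠ 0) : v.val = 1 := by
  revert v; decide

lemma zmod_two_val_le_one (v : ZMod 2) : v.val ≤ 1 := by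
  revert v; decide

lemma sum_tail_geometric (j0 k : ℕ) :
    ∑ j ∈ Finset.range (j0 + 1 + k), (if j0 < j then (1 : ℝ) / 2 ^ (j + 1) else 0) =
      1 / 2 ^ (j0 + 1) - 1 / 2 ^ (j0 + 1 + k) := by
  induction k with
  | zero =>
    rw [add_zero, sub_self]
    exact Finset.sum_eq_zero fun j hj => if_neg (by rw [Finset.mem_range] at hj; omega)
  | succ k ih =>
    rw [← add_assoc, Finset.sum_range_succ, ih, if_pos (by omega)]
    rw [pow_succ 2 (j0 + 1 + k)]
    field_simp
    ring

lemma single_digit_le {m : ℕ} (b : Fin m → ZMod 2) {j : Fin m} (hj : b j ≠ 0) :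
    (1 : ℝ) / 2 ^ (j.val + 1) ≤ ∑ j, ((b j).val : ℝ) / 2 ^ (j.val + 1) := by
  have := Finset.single_le_sum (f := fun j : Fin m => ((b j).val : ℝ) / 2 ^ (j.val + 1))
    (fun i _ => by positivity) (Finset.mem_univ j)
  simpa [zmod_two_val_eq_one hj] using this

lemma two_digits_le {m : ℕ} (b : Fin m → ZMod 2) {j k : Fin m} (hj : b j ≠ 0) (hk : b k ≠ 0)
    (hjk : j ≠ k) :
    (1 : ℝ) / 2 ^ (j.val + 1) + 1 / 2 ^ (k.val + 1) ≤ ∑ j, ((b j).val : ℝ) / 2 ^ (j.val + 1) := by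
  have := Finset.sum_le_sum_of_subset_of_nonneg (s := {j, k}) (t := Finset.univ)
    (f := fun j : Fin m => ((b j).val : ℝ) / 2 ^ (j.val + 1)) (Finset.subset_univ _)
    (fun i _ _ => by positivity)
  rw [Finset.sum_pair hjk] at this
  simpa [zmod_two_val_eq_one hj, zmod_two_val_eq_one hk] using this

lemma digits_eq_zero_of_lt {m d : ℕ} (b : Fin m → ZMod 2)
    (h : ∑ j, ((b j).val : ℝ) / 2 ^ (j.val + 1) < 1 / 2 ^ d) {j : Fin m} (hj : j.val < d) :
    b j = 0 := by
  by_contra hb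
  have h1 := single_digit_le b hb
  have h2 : (1 : ℝ) / 2 ^ d ≤ 1 / 2 ^ (j.val + 1) := by
    apply one_div_le_one_div_of_le (by positivity)
    exact pow_le_pow_right₀ (by norm_num) hj
  linarith

lemma digits_of_mem_box {m d : ℕ} (b : Fin m → ZMod 2) (j0 : Fin m) (hj0 : j0.val < d)
    (h1 : 1 / 2 ^ (j0.val + 1) ≤ ∑ j, ((b j).val : ℝ) / 2 ^ (j.val + 1))
    (h2 : ∑ j, ((b j).val : ℝ) / 2 ^ (j.val + 1) < 1 / 2 ^ (j0.val + 1) + 1 / 2 ^ d) :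
    b j0 = 1 ∧ ∀ j : Fin m, j.val < d → j ≠ j0 → b j = 0 := by
  have mono : ∀ p q : ℕ, p ≤ q → (1 : ℝ) / 2 ^ q ≤ 1 / 2 ^ p := fun p q hpq =>
    one_div_le_one_div_of_le (by positivity) (pow_le_pow_right₀ (by norm_num) hpq)
  have hlow : ∀ j : Fin m, j.val < j0.val → b j = 0 := by
    intro j hj
    by_contra hb
    have h3 := single_digit_le b hb
    have h4 := mono (j.val + 1) j0.val hj
    have h5 := mono (j0.val + 1) d hj0
    have h6 : (1 : ℝ) / 2 ^ j0.val = 1 / 2 ^ (j0.val + 1) + 1 / 2 ^ (j0.val + 1) := by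
      rw [pow_succ]; field_simp; norm_num
    linarith
  have hne : b j0 ≠ 0 := by
    intro hb
    obtain ⟨k, hk⟩ : ∃ k, m = j0.val + 1 + k := ⟨m - (j0.val + 1), by have := j0.isLt; omega⟩
    have h3 : ∑ j, ((b j).val : ℝ) / 2 ^ (j.val + 1) ≤
        ∑ j : Fin m, (if j0.val < j.val then (1 : ℝ) / 2 ^ (j.val + 1) else 0) := by
      refine Finset.sum_le_sum fun j _ => ?_
      split_ifs with hj
      · gcongr
        exact_mod_cast zmod_two_val_le_one (b j)
      · have : b j = 0 := by
          rcases lt_or_eq_of_le (not_lt.mp hj) with h | h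
          · exact hlow j h
          · rw [Fin.ext h, hb]
        simp [this]
    rw [Fin.sum_univ_eq_sum_range (fun j => if j0.val < j then (1 : ℝ) / 2 ^ (j + 1) else 0)] at h3
    have h4 := sum_tail_geometric j0.val k
    rw [← hk] at h4
    rw [h4] at h3
    have : (0 : ℝ) < 1 / 2 ^ m := by positivity
    linarith
  refine ⟨ZMod.val_injective 2 (zmod_two_val_eq_one hne), fun j hj hjj => ?_⟩
  by_contra hb
  have h3 := two_digits_le b hne hb hjj.symm
  have h4 := mono (j.val + 1) d hj
  linarith

lemma dualBox_eq_empty_of_sum_eq {m s tm : ℕ} {C : Fin s → Matrix (Fin m) (Fin m) (ZMod 2)}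
    (hnet : IsNet tm m s fun n : Fin (2 ^ m) => netPoint m s C (n : ℕ)) {A : Fin s → ℕ}
    (hA : (∑ i, A i) + tm = m) : dualBox m s C A = ∅ := by
  rw [Finset.eq_empty_iff_forall_notMem]
  intro x hx
  simp only [dualBox, dualNet, Finset.mem_filter, Finset.mem_univ, true_and, rhoF_le_iff] at hx
  obtain ⟨hdual, hne, hrho⟩ := hx
  obtain ⟨i0, j0, hij⟩ : ∃ i j, x i j ≠ 0 := by
    by_contra! H
    exact hne (funext fun i => funext fun j => H i j)
  have hj0 : j0.val < A i0 := by
    by_contra h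
    exact hij (hrho i0 j0 (not_lt.mp h))
  have hbox := hnet A (fun i => if i = i0 then 2 ^ (A i0 - j0.val - 1) else 0) (fun i => by
    split_ifs with h
    · subst h
      exact pow_lt_pow_right₀ (by norm_num) (by omega)
    · positivity) hA
  have hpos : 0 < (2 : ℕ) ^ tm := by positivity
  rw [← hbox, Finset.card_pos] at hpos
  obtain ⟨n, hn⟩ := hpos
  simp only [Finset.mem_filter, Finset.mem_univ, true_and] at hn
  have hdig : ∀ i j, x i j * netDig m s C n i j = if i = i0 ∧ j = j0 then 1 else 0 := by
    intro i j
    have hni := hn i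
    unfold netPoint at hni
    by_cases hjA : j.val < A i
    · by_cases hi : i = i0
      · subst hi
        simp only [if_true] at hni
        have e : ((2 ^ (A i - j0.val - 1) : ℕ) : ℝ) / 2 ^ A i = 1 / 2 ^ (j0.val + 1) := by
          rw [div_eq_div_iff (by positivity) (by positivity)]
          push_cast
          rw [← pow_add, one_mul]
          congr 1; omega
        rw [add_div, e] at hni
        have := digits_of_mem_box _ j0 hj0 hni.1 hni.2
        by_cases hj : j = j0
        · subst hj
          rw [this.1, mul_one, if_pos ⟨rfl, rfl⟩]
          exact ZMod.val_injective 2 (zmod_two_val_eq_one hij)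
        · rw [this.2 j hjA hj, mul_zero, if_neg (fun h => hj h.2)]
      · simp only [if_neg hi, Nat.cast_zero, zero_add] at hni
        rw [digits_eq_zero_of_lt _ hni.2 hjA, mul_zero, if_neg (fun h => hi h.1)]
    · rw [hrho i j (not_lt.mp hjA), zero_mul, if_neg]
      rintro ⟨rfl, rfl⟩
      exact hjA hj0
  have := hdual n
  simp_rw [hdig] at this
  rw [Finset.sum_eq_single i0 (fun i _ hi => by simp [hi]) (by simp),
    Finset.sum_eq_single j0 (fun j _ hj => by simp [hj]) (by simp)] at this
  simp at this

lemma dualBox_mono {m s : ℕ} {C : Fin s → Matrix (Fin m) (Fin m) (ZMod 2)} {A B : Fin s → ℕ}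
    (h : ∀ i, A i ≤ B i) : dualBox m s C A ⊆ dualBox m s C B := by
  intro x hx
  simp only [dualBox, Finset.mem_filter] at *
  exact ⟨hx.1, hx.2.1, fun i => (hx.2.2 i).trans (h i)⟩

lemma dualBox_eq_empty {m s tm : ℕ} (hs : 0 < s) (htm : tm ≤ m)
    {C : Fin s → Matrix (Fin m) (Fin m) (ZMod 2)}
    (hnet : IsNet tm m s fun n : Fin (2 ^ m) => netPoint m s C (n : ℕ)) {A : Fin s → ℕ}
    (hA : a0F A ≤ m - tm) : dualBox m s C A = ∅ := by
  unfold a0F at hA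
  rw [← Finset.subset_empty, ← dualBox_eq_empty_of_sum_eq (C := C) hnet
    (A := A + Pi.single ⟨0, hs⟩ (m - tm - ∑ i, A i))]
  · exact dualBox_mono fun i => by simp
  · simp only [Pi.add_apply, Finset.sum_add_distrib, Finset.sum_pi_single', Finset.mem_univ, if_true]
    omega

lemma exists_le_sum_eq {s : ℕ} (A : Fin s → ℕ) (n : ℕ) (h : n ≤ ∑ i, A i) :
    ∃ B : Fin s → ℕ, (∀ i, B i ≤ A i) ∧ ∑ i, B i = n := by
  induction hk : (∑ i, A i) - n generalizing A with
  | zero => exact ⟨A, fun _ => le_rfl, by omega⟩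
  | succ k ih =>
    obtain ⟨i, -, hi⟩ : ∃ i ∈ Finset.univ, A i ≠ 0 :=
      Finset.exists_ne_zero_of_sum_ne_zero (by omega)
    have hsum : ∑ j, Function.update A i (A i - 1) j + 1 = ∑ j, A j := by
      rw [Finset.sum_update_of_mem (Finset.mem_univ i),
        ← Finset.add_sum_erase _ _ (Finset.mem_univ i), Finset.erase_eq]
      omega
    obtain ⟨B, hB, hBn⟩ := ih (Function.update A i (A i - 1)) (by omega) (by omega)
    refine ⟨B, fun j => (hB j).trans ?_, hBn⟩
    by_cases hj : j = i
    · subst hj; simp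
    · simp [hj]

lemma card_dualBox_le {m s tm : ℕ} (hs : 0 < s) (htm : tm ≤ m)
    {C : Fin s → Matrix (Fin m) (Fin m) (ZMod 2)}
    (hnet : IsNet tm m s fun n : Fin (2 ^ m) => netPoint m s C (n : ℕ)) {A : Fin s → ℕ}
    (hA : m - tm ≤ a0F A) : (dualBox m s C A).card ≤ 2 ^ (a0F A - (m - tm)) := by
  obtain ⟨B, hBA, hB⟩ := exists_le_sum_eq A (m - tm) hA
  have hcard : Fintype.card ((Σ i : Fin s, Fin (A i - B i)) → ZMod 2) = 2 ^ (a0F A - (m - tm)) := by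
    rw [Fintype.card_fun, Fintype.card_sigma, ZMod.card]
    congr 1
    simp only [Fintype.card_fin]
    rw [Finset.sum_tsub_distrib _ (fun i _ => hBA i), hB, a0F]
  rw [← hcard, ← Finset.card_univ]
  refine Finset.card_le_card_of_injOn (fun x p => if h : B p.1 + p.2.val < m then
    x p.1 ⟨B p.1 + p.2.val, h⟩ else 0) (fun _ _ => Finset.mem_coe.mpr (Finset.mem_univ _)) ?_
  intro x hx y hy hxy
  by_contra hne
  have hxyA := dualBox_add hx hy hne
  have : x + y ∈ dualBox m s C B := by
    simp only [dualBox, Finset.mem_filter, rhoF_le_iff] at hxyA ⊢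
    refine ⟨hxyA.1, hxyA.2.1, fun i j hj => ?_⟩
    by_cases hjA : A i ≤ j.val
    · exact hxyA.2.2 i j hjA
    · have h := congrFun hxy ⟨i, ⟨j.val - B i, by omega⟩⟩
      have hm : B i + (j.val - B i) < m := by have := j.isLt; omega
      simp only [dif_pos hm] at h
      have e : (⟨B i + (j.val - B i), hm⟩ : Fin m) = j := Fin.ext (by simp; omega)
      rw [e] at h
      rw [Pi.add_apply, Pi.add_apply, h]
      exact CharTwo.add_self_eq_zero _
  rw [dualBox_eq_empty hs htm hnet (A := B) hB.le] at this
  exact absurd this (Finset.notMem_empty _)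

lemma dualBox_nonempty {m s : ℕ} (C : Fin s → Matrix (Fin m) (Fin m) (ZMod 2)) {A : Fin s → ℕ}
    (hAm : ∀ i, A i ≤ m) (hA : m < a0F A) : (dualBox m s C A).Nonempty := by
  let ext : ((Σ i : Fin s, Fin (A i)) → ZMod 2) → Fin s → Fin m → ZMod 2 :=
    fun x i j => if h : j.val < A i then x ⟨i, ⟨j.val, h⟩⟩ else 0
  obtain ⟨x, y, hne, hxy⟩ := Fintype.exists_ne_map_eq_of_card_lt
    (fun (x : (Σ i : Fin s, Fin (A i)) → ZMod 2) (r : Fin m) => ∑ i, ∑ j, ext x i j * C i j r) (by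
      rw [Fintype.card_fun, Fintype.card_fun, Fintype.card_sigma, ZMod.card]
      simp only [Fintype.card_fin]
      exact pow_lt_pow_right₀ (by norm_num) hA)
  refine ⟨ext x + ext y, ?_⟩
  simp only [dualBox, dualNet, Finset.mem_filter, Finset.mem_univ, true_and, rhoF_le_iff]
  refine ⟨fun n => ?_, fun h => hne ?_, fun i j hj => ?_⟩
  · have h1 : ∀ x : Fin s → Fin m → ZMod 2, ∑ i, ∑ j, x i j * netDig m s C n i j =
        ∑ r : Fin m, (∑ i, ∑ j, x i j * C i j r) * (if (n : ℕ).testBit r then 1 else 0) := by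
      intro x
      simp only [netDig, Finset.mul_sum, Finset.sum_mul]
      rw [Finset.sum_comm]
      rw [Finset.sum_comm]
      rw [Finset.sum_comm (s := (Finset.univ : Finset (Fin m)))]
      refine Finset.sum_congr rfl fun i _ => ?_
      rw [Finset.sum_comm]
      refine Finset.sum_congr rfl fun j _ => Finset.sum_congr rfl fun r _ => ?_
      ring
    have h2 : ∀ r, ∑ i, ∑ j, (ext x + ext y) i j * C i j r = 0 := by
      intro r
      have := congrFun hxy r
      simp only [Pi.add_apply, add_mul, Finset.sum_add_distrib] at *
      rw [this]
      exact CharTwo.add_self_eq_zero _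
    rw [h1]
    exact Finset.sum_eq_zero fun r _ => by rw [h2, zero_mul]
  · have := (zmod_two_pi_add_eq_zero _ _).mp h
    funext p
    have h3 := congrFun (congrFun this p.1) ⟨p.2.val, p.2.isLt.trans_le (hAm _)⟩
    simpa [ext] using h3
  · simp [ext, not_lt.mpr hj]

/-- The multi-indices in `I` have entries at most `m` and entry sum in `(lo, lo + L]`. -/
def InWindow {s : ℕ} (I : Finset (Fin s → ℕ)) (m lo L : ℕ) : Prop :=
  ∀ A ∈ I, (∀ i, A i ≤ m) ∧ lo < a0F A ∧ a0F A ≤ lo + L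

lemma card_ne_one {s : ℕ} (i0 : Fin s) : Fintype.card {i : Fin s // i ≠ i0} = s - 1 := by
  rw [Fintype.card_subtype_compl]
  simp

lemma card_ne_two {s : ℕ} {i0 k0 : Fin s} (h : k0 ≠ i0) :
    Fintype.card {i : Fin s // i ≠ i0 ∧ i ≠ k0} = s - 2 := by
  rw [Fintype.card_subtype]
  have : (Finset.univ.filter fun i : Fin s => i ≠ i0 ∧ i ≠ k0) = (Finset.univ.erase i0).erase k0 := by
    ext i; simp [and_comm]
  rw [this, Finset.card_erase_of_mem (by simp [h]), Finset.card_erase_of_mem (by simp)]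
  simp
  omega

lemma eq_of_sum_eq_of_eq_off {s : ℕ} {A B : Fin s → ℕ} (i0 : Fin s) (h : ∀ i, i ≠ i0 → A i = B i)
    (hs : a0F A = a0F B) : A = B := by
  have hA : A i0 + ∑ i ∈ Finset.univ.erase i0, A i = a0F A :=
    Finset.add_sum_erase _ _ (Finset.mem_univ i0)
  have hB : B i0 + ∑ i ∈ Finset.univ.erase i0, B i = a0F B :=
    Finset.add_sum_erase _ _ (Finset.mem_univ i0)
  have hAB : ∑ i ∈ Finset.univ.erase i0, A i = ∑ i ∈ Finset.univ.erase i0, B i :=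
    Finset.sum_congr rfl fun i hi => h i (Finset.ne_of_mem_erase hi)
  funext i
  by_cases hi : i = i0
  · subst hi; omega
  · exact h i hi

lemma card_fiber_le {s m lo L : ℕ} {I : Finset (Fin s → ℕ)} (hI : InWindow I m lo L)
    {i0 i1 : Fin s} (h01 : i1 ≠ i0) (a : ℕ) :
    (I.filter fun A => A i0 = a).card ≤ (m + 1) ^ (s - 2) * L := by
  have hT : ((Fintype.piFinset fun _ : {i : Fin s // i ≠ i0 ∧ i ≠ i1} => Finset.range (m + 1)) ×ˢ
      Finset.range L).card = (m + 1) ^ (s - 2) * L := by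
    rw [Finset.card_product, Fintype.card_piFinset]
    simp [card_ne_two h01]
  rw [← hT]
  refine Finset.card_le_card_of_injOn (fun A => (fun i => A i.1, a0F A - lo - 1)) ?_ ?_
  · intro A hA
    rw [Finset.mem_coe, Finset.mem_filter] at hA
    have h := hI A hA.1
    rw [Finset.mem_coe, Finset.mem_product, Fintype.mem_piFinset, Finset.mem_range]
    exact ⟨fun i => Finset.mem_range.mpr (Nat.lt_succ_of_le (h.1 _)), by dsimp only; omega⟩
  · intro A hA B hB hAB
    rw [Finset.mem_coe, Finset.mem_filter] at hA hB
    have hA' := hI A hA.1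
    have hB' := hI B hB.1
    simp only [Prod.mk.injEq] at hAB
    refine eq_of_sum_eq_of_eq_off i1 (fun i hi => ?_) (by omega)
    by_cases hi0 : i = i0
    · rw [hi0, hA.2, hB.2]
    · exact congrFun hAB.1 ⟨i, hi0, hi⟩

lemma card_window_le {s m lo L : ℕ} {I : Finset (Fin s → ℕ)} (hI : InWindow I m lo L)
    (i0 : Fin s) : I.card ≤ (m + 1) ^ (s - 1) * L := by
  have hT : ((Fintype.piFinset fun _ : {i : Fin s // i ≠ i0} => Finset.range (m + 1)) ×ˢ
      Finset.range L).card = (m + 1) ^ (s - 1) * L := by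
    rw [Finset.card_product, Fintype.card_piFinset]
    simp
  rw [← hT]
  refine Finset.card_le_card_of_injOn (fun A => (fun i => A i.1, a0F A - lo - 1)) ?_ ?_
  · intro A hA
    have h := hI A hA
    rw [Finset.mem_coe, Finset.mem_product, Fintype.mem_piFinset, Finset.mem_range]
    exact ⟨fun i => Finset.mem_range.mpr (Nat.lt_succ_of_le (h.1 _)), by dsimp only; omega⟩
  · intro A hA B hB hAB
    have hA' := hI A hA
    have hB' := hI B hB
    simp only [Prod.mk.injEq] at hAB
    exact eq_of_sum_eq_of_eq_off i0 (fun i hi => congrFun hAB.1 ⟨i, hi⟩) (by omega)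

/-- Pairs of distinct multi-indices that agree in the coordinate `i0`. -/
def offPairs {s : ℕ} (I : Finset (Fin s → ℕ)) (i0 : Fin s) :
    Finset ((Fin s → ℕ) × (Fin s → ℕ)) :=
  (I ×ˢ I).filter fun p => p.1 ≠ p.2 ∧ p.1 i0 = p.2 i0

/-- Quadruples of multi-indices whose Rademacher functions multiply to one. -/
def quads {s : ℕ} (I : Finset (Fin s → ℕ)) (i0 : Fin s) :
    Finset (((Fin s → ℕ) × (Fin s → ℕ)) × ((Fin s → ℕ) × (Fin s → ℕ))) :=
  (offPairs I i0 ×ˢ offPairs I i0).filter fun q =>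
    ∀ i, Paired (q.1.1 i) (q.1.2 i) (q.2.1 i) (q.2.2 i)

/-- The three ways in which four indices can cancel in pairs. -/
def PairedBy (r : Fin 3) (a b c d : ℕ) : Prop :=
  (r = 0 → a = b ∧ c = d) ∧ (r = 1 → a = c ∧ b = d) ∧ (r = 2 → a = d ∧ b = c)

lemma Paired.exists_pairedBy {a b c d : ℕ} (h : Paired a b c d) : ∃ r, PairedBy r a b c d := by
  rcases h with h | h | h
  · exact ⟨0, by simp [PairedBy, h]⟩
  · exact ⟨1, by simp [PairedBy, h]⟩
  · exact ⟨2, by simp [PairedBy, h]⟩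

/-- The quadruples with a prescribed pairing pattern. -/
def quadsBy {s : ℕ} (I : Finset (Fin s → ℕ)) (i0 : Fin s) (p : Fin s → Fin 3) (k0 : Fin s) :
    Finset (((Fin s → ℕ) × (Fin s → ℕ)) × ((Fin s → ℕ) × (Fin s → ℕ))) :=
  (quads I i0).filter fun q =>
    q.1.1 k0 ≠ q.1.2 k0 ∧ ∀ i, PairedBy (p i) (q.1.1 i) (q.1.2 i) (q.2.1 i) (q.2.2 i)

lemma card_quadsBy_le {s m lo L : ℕ} {I : Finset (Fin s → ℕ)} (hI : InWindow I m lo L)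
    (i0 : Fin s) (p : Fin s → Fin 3) (k0 : Fin s) :
    (quadsBy I i0 p k0).card ≤ (m + 1) ^ (s - 1) * ((m + 1) ^ (s - 2) * (L * (L * L))) := by
  have hmem : ∀ q ∈ quadsBy I i0 p k0, q.1.1 ∈ I ∧ q.1.2 ∈ I ∧ q.2.1 ∈ I ∧
      q.1.1 i0 = q.1.2 i0 ∧ q.1.1 k0 ≠ q.1.2 k0 ∧
      ∀ i, PairedBy (p i) (q.1.1 i) (q.1.2 i) (q.2.1 i) (q.2.2 i) := by
    intro q hq
    simp only [quadsBy, quads, offPairs, Finset.mem_filter, Finset.mem_product] at hq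
    tauto
  by_cases hk : k0 = i0
  · have : quadsBy I i0 p k0 = ∅ := by
      rw [Finset.eq_empty_iff_forall_notMem]
      intro q hq
      obtain ⟨-, -, -, h1, h2, -⟩ := hmem q hq
      rw [hk] at h2
      exact h2 h1
    simp [this]
  have hT : ((Fintype.piFinset fun _ : {i : Fin s // i ≠ i0} => Finset.range (m + 1)) ×ˢ
      ((Fintype.piFinset fun _ : {i : Fin s // i ≠ i0 ∧ i ≠ k0} => Finset.range (m + 1)) ×ˢ
      (Finset.range L ×ˢ (Finset.range L ×ˢ Finset.range L)))).card =
      (m + 1) ^ (s - 1) * ((m + 1) ^ (s - 2) * (L * (L * L))) := by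
    simp only [Finset.card_product, Fintype.card_piFinset, Finset.card_range, Finset.prod_const,
      Finset.card_univ, card_ne_one, card_ne_two hk]
  rw [← hT]
  refine Finset.card_le_card_of_injOn (fun q => (fun i => q.1.1 i.1,
    (fun i => if p i.1 = 0 then q.2.1 i.1 else q.1.2 i.1,
      (a0F q.1.1 - lo - 1, (a0F q.1.2 - lo - 1, a0F q.2.1 - lo - 1))))) ?_ ?_
  · intro q hq
    obtain ⟨hA, hB, hC, -⟩ := hmem q hq
    have hA := hI _ hA
    have hB := hI _ hB
    have hC := hI _ hC
    simp only [Finset.coe_product, Set.mem_prod, Finset.mem_coe, Fintype.mem_piFinset,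
      Finset.mem_range]
    refine ⟨fun i => Nat.lt_succ_of_le (hA.1 _), fun i => ?_, by omega, by omega, by omega⟩
    split_ifs
    · exact Nat.lt_succ_of_le (hC.1 _)
    · exact Nat.lt_succ_of_le (hB.1 _)
  · rintro ⟨⟨A, B⟩, C, D⟩ hq ⟨⟨A', B'⟩, C', D'⟩ hq' h
    obtain ⟨hA, hB, hC, h0, hne, hp⟩ := hmem _ hq
    obtain ⟨hA', hB', hC', h0', hne', hp'⟩ := hmem _ hq'
    have hA := hI _ hA
    have hB := hI _ hB
    have hC := hI _ hC
    have hA' := hI _ hA'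
    have hB' := hI _ hB'
    have hC' := hI _ hC'
    simp only [Prod.mk.injEq] at h hp hp' h0 h0' hne hne' hA hB hC hA' hB' hC'
    obtain ⟨hf, hg, ha, hb, hc⟩ := h
    have eA : A = A' := eq_of_sum_eq_of_eq_off i0 (fun i hi => congrFun hf ⟨i, hi⟩) (by omega)
    subst eA
    have eB : B = B' := by
      refine eq_of_sum_eq_of_eq_off k0 (fun i hi => ?_) (by omega)
      by_cases hi0 : i = i0
      · subst hi0; rw [← h0, ← h0']
      by_cases hpi : p i = 0
      · rw [← ((hp i).1 hpi).1, ← ((hp' i).1 hpi).1]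
      · have := congrFun hg ⟨i, hi0, hi⟩
        simpa [hpi] using this
    subst eB
    have hpk : p k0 ≠ 0 := fun h => hne ((hp k0).1 h).1
    have eC : C = C' := by
      refine eq_of_sum_eq_of_eq_off i0 (fun i hi => ?_) (by omega)
      have h3 : p i = 0 ∨ p i = 1 ∨ p i = 2 := by
        generalize p i = r
        revert r; decide
      rcases h3 with hpi | hpi | hpi
      · have hik : i ≠ k0 := fun h => hpk (h ▸ hpi)
        have := congrFun hg ⟨i, hi, hik⟩
        simpa [hpi] using this
      · rw [← ((hp i).2.1 hpi).1, ← ((hp' i).2.1 hpi).1]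
      · rw [← ((hp i).2.2 hpi).2, ← ((hp' i).2.2 hpi).2]
    subst eC
    have eD : D = D' := by
      funext i
      have h3 : p i = 0 ∨ p i = 1 ∨ p i = 2 := by
        generalize p i = r
        revert r; decide
      rcases h3 with hpi | hpi | hpi
      · rw [← ((hp i).1 hpi).2, ← ((hp' i).1 hpi).2]
      · rw [← ((hp i).2.1 hpi).2, ← ((hp' i).2.1 hpi).2]
      · rw [← ((hp i).2.2 hpi).1, ← ((hp' i).2.2 hpi).1]
    subst eD
    rfl

lemma card_quads_le {s m lo L : ℕ} {I : Finset (Fin s → ℕ)} (hI : InWindow I m lo L)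
    (i0 : Fin s) :
    (quads I i0).card ≤ 3 ^ s * s * ((m + 1) ^ (s - 1) * ((m + 1) ^ (s - 2) * (L * (L * L)))) := by
  have hsub : quads I i0 ⊆ (Finset.univ : Finset ((Fin s → Fin 3) × Fin s)).biUnion
      fun pk => quadsBy I i0 pk.1 pk.2 := by
    intro q hq
    have hq' := hq
    simp only [quads, offPairs, Finset.mem_filter, Finset.mem_product] at hq'
    obtain ⟨⟨⟨-, hne, -⟩, -⟩, hp⟩ := hq'
    choose r hr using fun i => (hp i).exists_pairedBy
    obtain ⟨k0, hk0⟩ : ∃ k, q.1.1 k ≠ q.1.2 k := by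
      by_contra! H
      exact hne (funext H)
    rw [Finset.mem_biUnion]
    exact ⟨(r, k0), Finset.mem_univ _, Finset.mem_filter.mpr ⟨hq, hk0, hr⟩⟩
  refine (Finset.card_le_card hsub).trans ((Finset.card_biUnion_le_card_mul _ _ _
    fun pk _ => card_quadsBy_le hI i0 pk.1 pk.2).trans (le_of_eq ?_))
  simp

lemma card_close_le {s m lo L : ℕ} {I : Finset (Fin s → ℕ)} (hI : InWindow I m lo L) :
    ((I ×ˢ I).filter fun p => lo < a0F (p.1 ⊓ p.2)).card ≤ (2 * L + 1) ^ s * I.card := by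
  refine Finset.card_le_mul_card_image_of_maps_to (f := Prod.fst) (fun p hp => ?_) _ fun A hA => ?_
  · rw [Finset.mem_filter, Finset.mem_product] at hp
    exact hp.1.1
  · have hT : (Fintype.piFinset fun i => Finset.Icc (A i - L) (A i + L)).card ≤ (2 * L + 1) ^ s := by
      rw [Fintype.card_piFinset]
      refine (Finset.prod_le_pow_card _ _ (2 * L + 1) fun i _ => ?_).trans (by simp)
      rw [Nat.card_Icc]; omega
    refine (Finset.card_le_card_of_injOn Prod.snd ?_ ?_).trans hT
    · rintro ⟨A', B⟩ hp
      simp only [Finset.coe_filter, Finset.mem_filter, Finset.mem_product, Set.mem_ofPred_eq] at hp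
      obtain ⟨⟨⟨hA', hB⟩, hlo⟩, rfl⟩ := hp
      have h1 := (hI _ hA').2.2
      have h2 := (hI _ hB).2.2
      rw [Finset.mem_coe, Fintype.mem_piFinset]
      intro i
      have hc : ∀ X : Fin s → ℕ, a0F X ≤ lo + L → (∀ j, (A' ⊓ B) j ≤ X j) →
          X i < (A' ⊓ B) i + L := by
        intro X hX hXle
        unfold a0F at hX hlo
        rw [← Finset.add_sum_erase _ _ (Finset.mem_univ i)] at hX hlo
        have := Finset.sum_le_sum (s := Finset.univ.erase i) fun j _ => hXle j
        simp only [Pi.inf_apply] at *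
        omega
      have hcA := hc A' h1 fun j => inf_le_left
      have hcB := hc B h2 fun j => inf_le_right
      simp only [Pi.inf_apply] at hcA hcB
      have h3 : A' i ⊓ B i ≤ A' i := inf_le_left
      have h4 : A' i ⊓ B i ≤ B i := inf_le_right
      rw [Finset.mem_Icc]
      dsimp only
      omega
    · rintro ⟨A1, B1⟩ h1 ⟨A2, B2⟩ h2 h
      simp only [Finset.coe_filter, Finset.mem_filter, Set.mem_ofPred_eq] at h1 h2
      simp only at h
      rw [Prod.mk.injEq]
      exact ⟨h1.2.trans h2.2.symm, h⟩

lemma pow_le_card_diagonal {s m : ℕ} (hs : 2 ≤ s) (i0 : Fin s) {T : Finset (Fin s → ℕ)}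
    (hT : ∀ A : Fin s → ℕ, (∀ i, A i ≤ m) → a0F A = m + 1 → A ∈ T) :
    (m / s) ^ (s - 1) ≤ T.card := by
  have hS : (Fintype.piFinset fun _ : {i : Fin s // i ≠ i0} => Finset.Icc 1 (m / s)).card =
      (m / s) ^ (s - 1) := by
    rw [Fintype.card_piFinset]
    simp
  rw [← hS]
  have hle : ∀ B ∈ (Fintype.piFinset fun _ : {i : Fin s // i ≠ i0} => Finset.Icc 1 (m / s)),
      (∀ i, 1 ≤ B i ∧ B i ≤ m / s) ∧ 1 ≤ ∑ i, B i ∧ ∑ i, B i ≤ m := by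
    intro B hB
    simp only [Fintype.mem_piFinset, Finset.mem_Icc] at hB
    refine ⟨hB, ?_, ?_⟩
    · have h1 : Finset.univ.card • 1 ≤ ∑ i, B i :=
        Finset.card_nsmul_le_sum Finset.univ B 1 fun i _ => (hB i).1
      rw [Finset.card_univ, card_ne_one, smul_eq_mul, mul_one] at h1
      omega
    · have h1 := Finset.sum_le_card_nsmul Finset.univ B (m / s) fun i _ => (hB i).2
      rw [Finset.card_univ, card_ne_one, smul_eq_mul] at h1
      calc _ ≤ (s - 1) * (m / s) := h1
        _ ≤ s * (m / s) := Nat.mul_le_mul_right _ (by omega)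
        _ ≤ m := Nat.mul_div_le m s
  refine Finset.card_le_card_of_injOn
    (fun B i => if h : i ≠ i0 then B ⟨i, h⟩ else m + 1 - ∑ j, B j) ?_ ?_
  · intro B hB
    obtain ⟨h1, h2, h3⟩ := hle B hB
    refine hT _ (fun i => ?_) ?_
    · dsimp only
      split_ifs with h
      · exact (h1 _).2.trans (Nat.div_le_self _ _)
      · omega
    · unfold a0F
      rw [← Finset.add_sum_erase _ _ (Finset.mem_univ i0)]
      rw [Finset.sum_subtype (Finset.univ.erase i0) (p := fun i => i ≠ i0) (by simp)]
      have h4 : ∑ x : {i : Fin s // i ≠ i0}, (if h : x.1 ≠ i0 then B ⟨x.1, h⟩ else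
          m + 1 - ∑ j, B j) = ∑ j, B j := Finset.sum_congr rfl fun x _ => dif_pos x.2
      dsimp only
      rw [dif_neg (by simp)]
      exact (congrArg (m + 1 - ∑ j, B j + ·) h4).trans
        (Nat.sub_add_cancel (h3.trans (Nat.le_succ m)))
  · intro B _ B' _ h
    funext i
    have := congrFun h i.1
    simpa [i.2] using this

section Moments

variable {s m : ℕ}

lemma expect_prod {α β : Type*} [Fintype α] [Fintype β] (f : α × β → ℝ) :
    𝔼 ω, f ω = 𝔼 a, 𝔼 b, f (a, b) := by
  rw [← Finset.univ_product_univ, Finset.expect_product]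

/-- The Rademacher sum with coefficients `c` over the index set `J`. -/
def radSum (c : (Fin s → ℕ) → (Fin s → Fin m → Fin 2) → ℝ) (J : Finset (Fin s → ℕ))
    (ω : (Fin s → Fin m → Fin 2) × (Fin s → Fin m → Fin 2)) : ℝ :=
  ∑ A ∈ J, c A ω.1 * rademF A ω.2

/-- The quadratic Rademacher sum with coefficients `c` over a set of pairs. -/
def pairSum (c : (Fin s → ℕ) → (Fin s → Fin m → Fin 2) → ℝ)
    (P : Finset ((Fin s → ℕ) × (Fin s → ℕ)))
    (ω : (Fin s → Fin m → Fin 2) × (Fin s → Fin m → Fin 2)) : ℝ :=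
  ∑ p ∈ P, c p.1 ω.1 * c p.2 ω.1 * (rademF p.1 ω.2 * rademF p.2 ω.2)

variable {c : (Fin s → ℕ) → (Fin s → Fin m → Fin 2) → ℝ}

lemma expect_radSum_sq {J : Finset (Fin s → ℕ)} (hJ : ∀ A ∈ J, ∀ i, A i ≤ m) :
    𝔼 ω, radSum c J ω ^ 2 = ∑ A ∈ J, 𝔼 z, c A z ^ 2 := by
  have h : ∀ z, 𝔼 y, radSum c J (z, y) ^ 2 = ∑ A ∈ J, c A z ^ 2 := by
    intro z
    simp only [radSum, sq, Finset.sum_mul_sum]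
    rw [Finset.expect_sum_comm]
    refine Finset.sum_congr rfl fun A hA => ?_
    rw [Finset.expect_sum_comm, Finset.sum_eq_single_of_mem A hA]
    · rw [Finset.expect_congr rfl (g := fun _ => c A z * c A z) fun y _ => by
        rw [mul_mul_mul_comm, rademF_mul_self, mul_one], Fintype.expect_const]
    · intro B hB hBA
      rw [Finset.expect_congr rfl (g := fun y => c A z * c B z * (rademF A y * rademF B y))
        fun y _ => mul_mul_mul_comm _ _ _ _, ← Finset.mul_expect,
        expect_radem_two_eq_zero (hJ A hA) (hJ B hB) hBA.symm, mul_zero]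
  rw [expect_prod, Finset.expect_congr rfl fun z _ => h z, Finset.expect_sum_comm]

lemma expect_pairSum_sq_le {P : Finset ((Fin s → ℕ) × (Fin s → ℕ))} {M : ℝ}
    (hP : ∀ p ∈ P, (∀ i, p.1 i ≤ m) ∧ ∀ i, p.2 i ≤ m)
    (hc : ∀ p ∈ P, ∀ z, |c p.1 z| ≤ M ∧ |c p.2 z| ≤ M) :
    𝔼 ω, pairSum c P ω ^ 2 ≤ M ^ 4 * ((P ×ˢ P).filter fun q =>
      ∀ i, Paired (q.1.1 i) (q.1.2 i) (q.2.1 i) (q.2.2 i)).card := by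
  have h : ∀ z, 𝔼 y, pairSum c P (z, y) ^ 2 ≤ M ^ 4 * ((P ×ˢ P).filter fun q =>
      ∀ i, Paired (q.1.1 i) (q.1.2 i) (q.2.1 i) (q.2.2 i)).card := by
    intro z
    simp only [pairSum, sq, Finset.sum_mul_sum]
    simp_rw [← Finset.sum_product']
    rw [Finset.expect_sum_comm, mul_comm, ← nsmul_eq_mul, ← Finset.sum_const, Finset.sum_filter]
    refine Finset.sum_le_sum fun q hq => ?_
    rw [Finset.mem_product] at hq
    obtain ⟨a1, a2⟩ := hc _ hq.1 z
    obtain ⟨a3, a4⟩ := hc _ hq.2 z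
    rw [Finset.expect_congr rfl (g := fun y => c q.1.1 z * c q.1.2 z * (c q.2.1 z * c q.2.2 z) *
        (rademF q.1.1 y * rademF q.1.2 y * rademF q.2.1 y * rademF q.2.2 y))
        fun y _ => by ring, ← Finset.mul_expect]
    split_ifs with hp
    · refine (le_abs_self _).trans ?_
      have h1 : |𝔼 y : Fin s → Fin m → Fin 2,
          rademF q.1.1 y * rademF q.1.2 y * rademF q.2.1 y * rademF q.2.2 y| ≤ 1 := by
        refine (Finset.abs_expect_le _ _).trans ?_
        simp [abs_mul, abs_rademF]
      have hM : 0 ≤ M := (abs_nonneg _).trans a1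
      rw [abs_mul, abs_mul, abs_mul, abs_mul]
      calc _ ≤ M * M * (M * M) * 1 := by gcongr
        _ = M ^ 4 := by ring
    · rw [expect_radem_four_eq_zero (hP _ hq.1).1 (hP _ hq.1).2 (hP _ hq.2).1 (hP _ hq.2).2 hp,
        mul_zero]
  rw [expect_prod]
  exact Finset.expect_le Finset.univ_nonempty fun z _ => h z

variable {lo L : ℕ} {I : Finset (Fin s → ℕ)} {M : ℝ}

/-- The part of the Rademacher sum whose indices have entry `a` in coordinate `i0`. -/
def fiberSum (c : (Fin s → ℕ) → (Fin s → Fin m → Fin 2) → ℝ) (I : Finset (Fin s → ℕ))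
    (i0 : Fin s) (a : ℕ) : (Fin s → Fin m → Fin 2) × (Fin s → Fin m → Fin 2) → ℝ :=
  radSum c (I.filter fun A => A i0 = a)

lemma radSum_eq_sum_fiberSum (hI : InWindow I m lo L) (i0 : Fin s)
    (ω : (Fin s → Fin m → Fin 2) × (Fin s → Fin m → Fin 2)) :
    radSum c I ω = ∑ a ∈ Finset.range (m + 1), fiberSum c I i0 a ω := by
  unfold fiberSum radSum
  exact (Finset.sum_fiberwise_of_maps_to
    (fun A hA => Finset.mem_range.mpr (Nat.lt_succ_of_le ((hI A hA).1 i0))) _).symm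

lemma fiberSum_sq (i0 : Fin s) (a : ℕ)
    (ω : (Fin s → Fin m → Fin 2) × (Fin s → Fin m → Fin 2)) :
    fiberSum c I i0 a ω ^ 2 = ∑ A ∈ I.filter (fun A => A i0 = a), c A ω.1 ^ 2 +
      pairSum c ((offPairs I i0).filter fun p => p.1 i0 = a) ω := by
  have hset : ((I.filter fun A => A i0 = a) ×ˢ (I.filter fun A => A i0 = a)).filter
      (fun p => ¬ p.1 = p.2) = (offPairs I i0).filter fun p => p.1 i0 = a := by
    ext p
    simp only [offPairs, Finset.mem_filter, Finset.mem_product]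
    constructor
    · rintro ⟨⟨⟨h1, h2⟩, h3, h4⟩, h5⟩
      exact ⟨⟨⟨h1, h3⟩, h5, h2.trans h4.symm⟩, h2⟩
    · rintro ⟨⟨⟨h1, h3⟩, h5, h6⟩, h2⟩
      exact ⟨⟨⟨h1, h2⟩, h3, h6.symm.trans h2⟩, h5⟩
  rw [fiberSum, radSum, sq, Finset.sum_mul_sum, ← Finset.sum_product',
    ← Finset.sum_filter_add_sum_filter_not _ (fun p => p.1 = p.2), hset]
  congr 1
  · have hd : ((I.filter fun A => A i0 = a) ×ˢ (I.filter fun A => A i0 = a)).filter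
        (fun p => p.1 = p.2) = (I.filter fun A => A i0 = a).diag := by
      ext p
      simp only [Finset.mem_filter, Finset.mem_product, Finset.mem_diag]
      constructor
      · rintro ⟨⟨h1, -⟩, h⟩
        exact ⟨h1, h⟩
      · rintro ⟨h1, h⟩
        exact ⟨⟨h1, h ▸ h1⟩, h⟩
    rw [hd, Finset.sum_diag]
    refine Finset.sum_congr rfl fun A _ => ?_
    rw [mul_mul_mul_comm, rademF_mul_self, mul_one, sq]
  · exact Finset.sum_congr rfl fun p _ => mul_mul_mul_comm _ _ _ _

lemma expect_fiberSum_sq_le (hI : InWindow I m lo L) (hc : ∀ A ∈ I, ∀ z, |c A z| ≤ M)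
    {i0 i1 : Fin s} (h01 : i1 ≠ i0) (a : ℕ) :
    𝔼 ω, fiberSum c I i0 a ω ^ 2 ≤ M ^ 2 * ((m + 1 : ℝ) ^ (s - 2) * L) := by
  rw [fiberSum, expect_radSum_sq fun A hA => (hI A (Finset.mem_filter.mp hA).1).1]
  have h1 : ∀ A ∈ I.filter (fun A => A i0 = a), 𝔼 z, c A z ^ 2 ≤ M ^ 2 := fun A hA =>
    Finset.expect_le Finset.univ_nonempty fun z _ =>
      sq_le_sq' (abs_le.mp (hc A (Finset.mem_filter.mp hA).1 z)).1
        (abs_le.mp (hc A (Finset.mem_filter.mp hA).1 z)).2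
  refine (Finset.sum_le_card_nsmul _ _ _ h1).trans ?_
  rw [nsmul_eq_mul, mul_comm]
  refine mul_le_mul_of_nonneg_left ?_ (sq_nonneg M)
  exact_mod_cast card_fiber_le hI h01 a

lemma diag_fiber_le (hI : InWindow I m lo L) (hc : ∀ A ∈ I, ∀ z, |c A z| ≤ M)
    {i0 i1 : Fin s} (h01 : i1 ≠ i0) (a : ℕ) (z : Fin s → Fin m → Fin 2) :
    ∑ A ∈ I.filter (fun A => A i0 = a), c A z ^ 2 ≤ M ^ 2 * ((m + 1 : ℝ) ^ (s - 2) * L) := by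
  have h1 : ∀ A ∈ I.filter (fun A => A i0 = a), c A z ^ 2 ≤ M ^ 2 := fun A hA =>
    sq_le_sq' (abs_le.mp (hc A (Finset.mem_filter.mp hA).1 z)).1
      (abs_le.mp (hc A (Finset.mem_filter.mp hA).1 z)).2
  refine (Finset.sum_le_card_nsmul _ _ _ h1).trans ?_
  rw [nsmul_eq_mul, mul_comm]
  refine mul_le_mul_of_nonneg_left ?_ (sq_nonneg M)
  exact_mod_cast card_fiber_le hI h01 a

lemma offPairs_spec {i0 : Fin s} {p : (Fin s → ℕ) × (Fin s → ℕ)} (hp : p ∈ offPairs I i0) :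
    p.1 ∈ I ∧ p.2 ∈ I := by
  simp only [offPairs, Finset.mem_filter, Finset.mem_product] at hp
  exact hp.1

lemma sum_expect_offSum_sq_le (hI : InWindow I m lo L) (hc : ∀ A ∈ I, ∀ z, |c A z| ≤ M)
    (i0 : Fin s) :
    ∑ a ∈ Finset.range (m + 1),
      𝔼 ω, pairSum c ((offPairs I i0).filter fun p => p.1 i0 = a) ω ^ 2 ≤
      M ^ 4 * (quads I i0).card := by
  have hcard : (quads I i0).card = ∑ a ∈ Finset.range (m + 1),
      ((quads I i0).filter fun q => q.1.1 i0 = a).card := by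
    refine Finset.card_eq_sum_card_fiberwise fun q hq => ?_
    rw [Finset.mem_coe, quads, Finset.mem_filter, Finset.mem_product] at hq
    exact Finset.mem_coe.mpr (Finset.mem_range.mpr
      (Nat.lt_succ_of_le ((hI _ (offPairs_spec hq.1.1).1).1 i0)))
  rw [hcard, Nat.cast_sum, Finset.mul_sum]
  refine Finset.sum_le_sum fun a _ => (expect_pairSum_sq_le (M := M) ?_ ?_).trans ?_
  · intro p hp
    have := offPairs_spec (Finset.mem_filter.mp hp).1
    exact ⟨(hI _ this.1).1, (hI _ this.2).1⟩
  · intro p hp z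
    have := offPairs_spec (Finset.mem_filter.mp hp).1
    exact ⟨hc _ this.1 z, hc _ this.2 z⟩
  · refine mul_le_mul_of_nonneg_left ?_ (by positivity)
    refine Nat.cast_le.mpr (Finset.card_le_card fun q hq => ?_)
    simp only [quads, Finset.mem_filter, Finset.mem_product] at hq ⊢
    exact ⟨⟨⟨hq.1.1.1, hq.1.2.1⟩, hq.2⟩, hq.1.1.2⟩

lemma expect_offSum_sq_le (hI : InWindow I m lo L) (hc : ∀ A ∈ I, ∀ z, |c A z| ≤ M)
    (i0 : Fin s) :
    𝔼 ω, pairSum c (offPairs I i0) ω ^ 2 ≤ M ^ 4 * (quads I i0).card := by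
  refine expect_pairSum_sq_le (fun p hp => ?_) fun p hp z => ?_
  · exact ⟨(hI _ (offPairs_spec hp).1).1, (hI _ (offPairs_spec hp).2).1⟩
  · exact ⟨hc _ (offPairs_spec hp).1 z, hc _ (offPairs_spec hp).2 z⟩

lemma sum_fiberSum_sq (hI : InWindow I m lo L) (i0 : Fin s)
    (ω : (Fin s → Fin m → Fin 2) × (Fin s → Fin m → Fin 2)) :
    ∑ a ∈ Finset.range (m + 1), fiberSum c I i0 a ω ^ 2 =
      ∑ A ∈ I, c A ω.1 ^ 2 + pairSum c (offPairs I i0) ω := by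
  simp_rw [fiberSum_sq, Finset.sum_add_distrib, pairSum]
  congr 1
  · exact Finset.sum_fiberwise_of_maps_to
      (fun A hA => Finset.mem_range.mpr (Nat.lt_succ_of_le ((hI A hA).1 i0))) _
  · exact Finset.sum_fiberwise_of_maps_to (fun p hp => Finset.mem_range.mpr
      (Nat.lt_succ_of_le ((hI _ (offPairs_spec hp).1).1 i0))) _

lemma sum_expect_fiberSum_pow_four_le (hI : InWindow I m lo L)
    (hc : ∀ A ∈ I, ∀ z, |c A z| ≤ M) {i0 i1 : Fin s} (h01 : i1 ≠ i0) :
    ∑ a ∈ Finset.range (m + 1), 𝔼 ω, fiberSum c I i0 a ω ^ 4 ≤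
      2 * ((m + 1) * (M ^ 2 * ((m + 1 : ℝ) ^ (s - 2) * L)) ^ 2 + M ^ 4 * (quads I i0).card) := by
  set K := M ^ 2 * ((m + 1 : ℝ) ^ (s - 2) * L) with hK
  have h : ∀ a, 𝔼 ω, fiberSum c I i0 a ω ^ 4 ≤ 2 * K ^ 2 +
      2 * 𝔼 ω, pairSum c ((offPairs I i0).filter fun p => p.1 i0 = a) ω ^ 2 := by
    intro a
    have h1 : 𝔼 ω, (2 * K ^ 2 +
        2 * pairSum c ((offPairs I i0).filter fun p => p.1 i0 = a) ω ^ 2) = 2 * K ^ 2 +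
        2 * 𝔼 ω, pairSum c ((offPairs I i0).filter fun p => p.1 i0 = a) ω ^ 2 := by
      rw [Finset.expect_add_distrib, Fintype.expect_const, Finset.mul_expect]
    rw [← h1]
    refine Finset.expect_le_expect fun ω _ => ?_
    have h2 := diag_fiber_le hI hc h01 a ω.1
    have h3 : 0 ≤ ∑ A ∈ I.filter (fun A => A i0 = a), c A ω.1 ^ 2 :=
      Finset.sum_nonneg fun A _ => sq_nonneg _
    rw [show fiberSum c I i0 a ω ^ 4 = (fiberSum c I i0 a ω ^ 2) ^ 2 by ring, fiberSum_sq]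
    nlinarith [sq_nonneg (∑ A ∈ I.filter (fun A => A i0 = a), c A ω.1 ^ 2 -
      pairSum c ((offPairs I i0).filter fun p => p.1 i0 = a) ω), pow_le_pow_left₀ h3 h2 2]
  calc _ ≤ ∑ a ∈ Finset.range (m + 1), (2 * K ^ 2 +
      2 * 𝔼 ω, pairSum c ((offPairs I i0).filter fun p => p.1 i0 = a) ω ^ 2) :=
        Finset.sum_le_sum fun a _ => h a
    _ ≤ _ := by
      rw [Finset.sum_add_distrib, Finset.sum_const, Finset.card_range, nsmul_eq_mul,
        ← Finset.mul_sum]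
      have := sum_expect_offSum_sq_le hI hc i0
      push_cast
      linarith

/-- The pairs of multi-indices whose meet has a large entry sum. -/
def closePairs (I : Finset (Fin s → ℕ)) (lo : ℕ) : Finset ((Fin s → ℕ) × (Fin s → ℕ)) :=
  (I ×ˢ I).filter fun p => lo < a0F (p.1 ⊓ p.2)

lemma variance_diag_le (hc : ∀ A ∈ I, ∀ z, |c A z| ≤ M)
    (hcov : ∀ A ∈ I, ∀ B ∈ I, a0F (A ⊓ B) ≤ lo →
      𝔼 z, c A z ^ 2 * c B z ^ 2 = (𝔼 z, c A z ^ 2) * 𝔼 z, c B z ^ 2) :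
    𝔼 z, (∑ A ∈ I, c A z ^ 2 - ∑ A ∈ I, 𝔼 z, c A z ^ 2) ^ 2 ≤
      M ^ 4 * (closePairs I lo).card := by
  have h0 : ∀ A, 0 ≤ 𝔼 z, c A z ^ 2 := fun A => Finset.expect_nonneg fun z _ => sq_nonneg _
  have h2 : ∀ A ∈ I, ∀ z, c A z ^ 2 ≤ M ^ 2 := fun A hA z =>
    sq_le_sq' (abs_le.mp (hc A hA z)).1 (abs_le.mp (hc A hA z)).2
  have h1 : ∀ A B, 𝔼 z, (c A z ^ 2 - 𝔼 z, c A z ^ 2) * (c B z ^ 2 - 𝔼 z, c B z ^ 2) =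
      𝔼 z, c A z ^ 2 * c B z ^ 2 - (𝔼 z, c A z ^ 2) * 𝔼 z, c B z ^ 2 := by
    intro A B
    simp_rw [sub_mul, mul_sub, Finset.expect_sub_distrib, ← Finset.mul_expect,
      ← Finset.expect_mul, Fintype.expect_const]
    ring
  simp_rw [← Finset.sum_sub_distrib, sq (∑ A ∈ I, _), Finset.sum_mul_sum,
    ← Finset.sum_product']
  rw [Finset.expect_sum_comm, mul_comm, ← nsmul_eq_mul, ← Finset.sum_const, closePairs,
    Finset.sum_filter]
  refine Finset.sum_le_sum fun p hp => ?_
  rw [Finset.mem_product] at hp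
  rw [h1]
  split_ifs with h
  · have h3 : 𝔼 z, c p.1 z ^ 2 * c p.2 z ^ 2 ≤ M ^ 4 :=
      Finset.expect_le Finset.univ_nonempty fun z _ => by
        calc _ ≤ M ^ 2 * M ^ 2 := mul_le_mul (h2 _ hp.1 z) (h2 _ hp.2 z) (sq_nonneg _) (sq_nonneg _)
          _ = M ^ 4 := by ring
    have := mul_nonneg (h0 p.1) (h0 p.2)
    linarith
  · rw [hcov _ hp.1 _ hp.2 (not_lt.mp h), sub_self]

lemma expect_abs_le_sqrt {Ω : Type*} [Fintype Ω] [Nonempty Ω] (f : Ω → ℝ) :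
    𝔼 ω, |f ω| ≤ Real.sqrt (𝔼 ω, f ω ^ 2) := by
  refine Real.le_sqrt_of_sq_le ?_
  have h : 0 ≤ 𝔼 ω, (|f ω| - 𝔼 ω, |f ω|) ^ 2 := Finset.expect_nonneg fun ω _ => sq_nonneg _
  have h1 : 𝔼 ω, (|f ω| - 𝔼 ω, |f ω|) ^ 2 = 𝔼 ω, f ω ^ 2 - (𝔼 ω, |f ω|) ^ 2 := by
    simp_rw [sub_sq, Finset.expect_add_distrib, Finset.expect_sub_distrib, ← Finset.expect_mul,
      ← Finset.mul_expect, Fintype.expect_const, sq_abs]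
    ring
  linarith

lemma expect_abs_sum_fiberSum_sq_sub_le (hI : InWindow I m lo L)
    (hc : ∀ A ∈ I, ∀ z, |c A z| ≤ M)
    (hcov : ∀ A ∈ I, ∀ B ∈ I, a0F (A ⊓ B) ≤ lo →
      𝔼 z, c A z ^ 2 * c B z ^ 2 = (𝔼 z, c A z ^ 2) * 𝔼 z, c B z ^ 2) (i0 : Fin s) :
    𝔼 ω, |∑ a ∈ Finset.range (m + 1), fiberSum c I i0 a ω ^ 2 - ∑ A ∈ I, 𝔼 z, c A z ^ 2| ≤
      Real.sqrt (2 * (M ^ 4 * (closePairs I lo).card) + 2 * (M ^ 4 * (quads I i0).card)) := by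
  refine (expect_abs_le_sqrt _).trans (Real.sqrt_le_sqrt ?_)
  have hv := variance_diag_le (lo := lo) hc hcov
  have hq := expect_offSum_sq_le hI hc i0
  set v := ∑ A ∈ I, 𝔼 z, c A z ^ 2
  have h1 : 𝔼 ω : (Fin s → Fin m → Fin 2) × (Fin s → Fin m → Fin 2),
      (2 * (∑ A ∈ I, c A ω.1 ^ 2 - v) ^ 2 + 2 * pairSum c (offPairs I i0) ω ^ 2) =
      2 * 𝔼 z, (∑ A ∈ I, c A z ^ 2 - v) ^ 2 + 2 * 𝔼 ω, pairSum c (offPairs I i0) ω ^ 2 := by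
    rw [Finset.expect_add_distrib, Finset.mul_expect, Finset.mul_expect]
    congr 1
    rw [expect_prod]
    simp_rw [Fintype.expect_const]
  calc _ ≤ 𝔼 ω : (Fin s → Fin m → Fin 2) × (Fin s → Fin m → Fin 2),
      (2 * (∑ A ∈ I, c A ω.1 ^ 2 - v) ^ 2 + 2 * pairSum c (offPairs I i0) ω ^ 2) := by
        refine Finset.expect_le_expect fun ω _ => ?_
        rw [sum_fiberSum_sq hI]
        nlinarith [sq_nonneg (∑ A ∈ I, c A ω.1 ^ 2 - v - pairSum c (offPairs I i0) ω)]
    _ ≤ _ := by rw [h1]; linarith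

end Moments

section CharacteristicFunction

variable {s m : ℕ} {c : (Fin s → ℕ) → (Fin s → Fin m → Fin 2) → ℝ}

lemma neg_one_pow_dAt_add (x y : Fin m → Fin 2) (a : ℕ) :
    (-1 : ℝ) ^ dAt (x + y) a = (-1) ^ dAt x a * (-1) ^ dAt y a := by
  unfold dAt
  split_ifs
  · exact neg_one_pow_fin_two_add _ _
  · simp

lemma rademF_add_single (A : Fin s → ℕ) (y : Fin s → Fin m → Fin 2) (i0 : Fin s)
    (ε : Fin m → Fin 2) :
    rademF A (y + Pi.single i0 ε) = (-1) ^ dAt ε (A i0) * rademF A y := by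
  have h : ∀ i, (-1 : ℝ) ^ dAt ((y + Pi.single i0 ε : Fin s → Fin m → Fin 2) i) (A i) =
      (if i = i0 then (-1) ^ dAt ε (A i0) else 1) * (-1) ^ dAt (y i) (A i) := by
    intro i
    rw [Pi.add_apply, neg_one_pow_dAt_add, mul_comm]
    congr 1
    split_ifs with hi
    · rw [hi, Pi.single_eq_same]
    · rw [Pi.single_eq_of_ne hi]
      simp [dAt]
  simp_rw [rademF, h, Finset.prod_mul_distrib, Finset.prod_ite_eq' Finset.univ i0]
  simp

/-- Flipping the digits `ε` of coordinate `i0` of the second digit array. -/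
def flipDigits (i0 : Fin s) (ε : Fin m → Fin 2) :
    Equiv.Perm ((Fin s → Fin m → Fin 2) × (Fin s → Fin m → Fin 2)) :=
  Equiv.prodCongr (Equiv.refl _) (Equiv.addRight (Pi.single i0 ε))

lemma fiberSum_flipDigits (I : Finset (Fin s → ℕ)) (i0 : Fin s) (ε : Fin m → Fin 2) (a : ℕ)
    (ω : (Fin s → Fin m → Fin 2) × (Fin s → Fin m → Fin 2)) :
    fiberSum c I i0 a (flipDigits i0 ε ω) = (-1) ^ dAt ε a * fiberSum c I i0 a ω := by
  unfold fiberSum radSum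
  rw [Finset.mul_sum]
  refine Finset.sum_congr rfl fun A hA => ?_
  rw [show flipDigits i0 ε ω = (ω.1, ω.2 + Pi.single i0 ε) from rfl, rademF_add_single,
    (Finset.mem_filter.mp hA).2]
  ring

variable {lo L : ℕ} {I : Finset (Fin s → ℕ)} {M : ℝ}

lemma norm_expect_exp_radSum_sub_le (hI : InWindow I m lo L) (hc : ∀ A ∈ I, ∀ z, |c A z| ≤ M)
    (hcov : ∀ A ∈ I, ∀ B ∈ I, a0F (A ⊓ B) ≤ lo →
      𝔼 z, c A z ^ 2 * c B z ^ 2 = (𝔼 z, c A z ^ 2) * 𝔼 z, c B z ^ 2)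
    {i0 i1 : Fin s} (h01 : i1 ≠ i0) {ρ δ : ℝ} (hρ : 0 < ρ)
    (hρ2 : ρ ^ 2 = ∑ A ∈ I, 𝔼 z, c A z ^ 2)
    (h1 : M ^ 2 * ((m + 1 : ℝ) ^ (s - 2) * L) ≤ δ * ρ ^ 2)
    (h2 : (m + 1) * (M ^ 2 * ((m + 1 : ℝ) ^ (s - 2) * L)) ^ 2 ≤ δ * ρ ^ 4)
    (h3 : M ^ 4 * (quads I i0).card ≤ δ * ρ ^ 4)
    (h4 : M ^ 4 * (closePairs I lo).card ≤ δ * ρ ^ 4) (θ : ℝ) :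
    ‖𝔼 ω, Complex.exp (Complex.I * ((θ * (radSum c I ω / ρ) : ℝ) : ℂ)) -
        ((Real.exp (-(θ ^ 2 / 2)) : ℝ) : ℂ)‖ ≤
      |θ| * Real.sqrt δ + 8 * θ ^ 4 * δ + θ ^ 2 / 2 * (2 * Real.sqrt δ + δ) := by
  set W := fiberSum c I i0 with hW
  have hsplit : ∀ f : ℕ → ℝ, ∑ a ∈ Finset.range (m + 1), f a = f 0 + ∑ j : Fin m, f (j + 1) := by
    intro f
    rw [Finset.sum_range_succ', add_comm, Finset.sum_range]
  have hsum : ∀ ω, θ * (radSum c I ω / ρ) =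
      θ / ρ * W 0 ω + ∑ j : Fin m, θ / ρ * W (j + 1) ω := by
    intro ω
    rw [radSum_eq_sum_fiberSum hI i0, hsplit, ← Finset.mul_sum]
    ring
  have key := norm_expect_exp_sub_gaussian_le (fun ω => θ / ρ * W 0 ω)
    (fun (j : Fin m) ω => θ / ρ * W (j + 1) ω) (flipDigits i0)
    (fun ε ω => by rw [hW, fiberSum_flipDigits]; simp [dAt])
    (fun ε j ω => by
      rw [hW, fiberSum_flipDigits]
      have : dAt ε (j + 1) = (ε j).val := by
        rw [dAt, dif_pos ⟨by omega, by omega⟩]; rfl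
      rw [this]; ring) θ
  simp_rw [← hsum] at key
  refine key.trans ?_
  have hW0 : 𝔼 ω, W 0 ω ^ 2 ≤ δ * ρ ^ 2 := (expect_fiberSum_sq_le hI hc h01 0).trans h1
  have hδ : 0 ≤ δ := by
    have : 0 ≤ 𝔼 ω, W 0 ω ^ 2 := Finset.expect_nonneg fun ω _ => sq_nonneg _
    exact nonneg_of_mul_nonneg_left (this.trans hW0) (by positivity)
  have b1 : 𝔼 ω, |θ / ρ * W 0 ω| ≤ |θ| * Real.sqrt δ := by
    simp_rw [abs_mul]
    rw [← Finset.mul_expect]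
    have : 𝔼 ω, |W 0 ω| ≤ Real.sqrt δ * ρ := by
      refine (expect_abs_le_sqrt _).trans ((Real.sqrt_le_sqrt hW0).trans (le_of_eq ?_))
      rw [Real.sqrt_mul hδ, Real.sqrt_sq hρ.le]
    calc _ ≤ |θ / ρ| * (Real.sqrt δ * ρ) := mul_le_mul_of_nonneg_left this (abs_nonneg _)
      _ = _ := by rw [abs_div, abs_of_pos hρ]; field_simp
  have b2 : 𝔼 ω, ∑ j : Fin m, (θ / ρ * W (j + 1) ω) ^ 4 ≤ 4 * θ ^ 4 * δ := by
    have h5 : ∑ j : Fin m, 𝔼 ω, W (j + 1) ω ^ 4 ≤ 4 * (δ * ρ ^ 4) := by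
      have h6 := sum_expect_fiberSum_pow_four_le hI hc h01
      rw [hsplit] at h6
      have h7 : 0 ≤ 𝔼 ω, fiberSum c I i0 0 ω ^ 4 :=
        Finset.expect_nonneg fun ω _ => by positivity
      linarith
    simp_rw [mul_pow]
    rw [Finset.expect_sum_comm]
    simp_rw [← Finset.mul_expect]
    rw [← Finset.mul_sum]
    calc _ ≤ (θ / ρ) ^ 4 * (4 * (δ * ρ ^ 4)) := mul_le_mul_of_nonneg_left h5 (by positivity)
      _ = _ := by field_simp
  have b3 : 𝔼 ω, |∑ j : Fin m, (θ / ρ * W (j + 1) ω) ^ 2 - θ ^ 2| ≤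
      θ ^ 2 * (2 * Real.sqrt δ + δ) := by
    have h5 : 𝔼 ω, |∑ a ∈ Finset.range (m + 1), W a ω ^ 2 - ρ ^ 2| ≤
        2 * Real.sqrt δ * ρ ^ 2 := by
      rw [hρ2]
      refine (expect_abs_sum_fiberSum_sq_sub_le hI hc hcov i0).trans ?_
      rw [← hρ2]
      refine Real.sqrt_le_iff.mpr ⟨by positivity, ?_⟩
      have := Real.sq_sqrt hδ
      calc _ ≤ 2 * (δ * ρ ^ 4) + 2 * (δ * ρ ^ 4) := by linarith
        _ = (2 * Real.sqrt δ * ρ ^ 2) ^ 2 := by rw [mul_pow, mul_pow, this]; ring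
    have h6 : ∀ ω, |∑ j : Fin m, (θ / ρ * W (j + 1) ω) ^ 2 - θ ^ 2| ≤
        (θ / ρ) ^ 2 * (|∑ a ∈ Finset.range (m + 1), W a ω ^ 2 - ρ ^ 2| + W 0 ω ^ 2) := by
      intro ω
      rw [hsplit fun a => W a ω ^ 2]
      simp_rw [mul_pow]
      rw [← Finset.mul_sum]
      set X := ∑ j : Fin m, W (j + 1) ω ^ 2
      have h7 : (θ / ρ) ^ 2 * X - θ ^ 2 = (θ / ρ) ^ 2 * (X - ρ ^ 2) := by field_simp
      rw [h7, abs_mul, abs_of_nonneg (sq_nonneg (θ / ρ))]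
      refine mul_le_mul_of_nonneg_left ?_ (sq_nonneg _)
      calc |X - ρ ^ 2| = |(W 0 ω ^ 2 + X - ρ ^ 2) - W 0 ω ^ 2| := by ring_nf
        _ ≤ |W 0 ω ^ 2 + X - ρ ^ 2| + |W 0 ω ^ 2| := abs_sub _ _
        _ = _ := by rw [abs_of_nonneg (sq_nonneg (W 0 ω))]
    refine (Finset.expect_le_expect fun ω _ => h6 ω).trans ?_
    rw [← Finset.mul_expect, Finset.expect_add_distrib]
    calc _ ≤ (θ / ρ) ^ 2 * (2 * Real.sqrt δ * ρ ^ 2 + δ * ρ ^ 2) := by gcongr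
      _ = _ := by field_simp
  linarith

end CharacteristicFunction

section Levy

open ProbabilityTheory

/-- The distribution of `X` under the uniform measure on a finite type. -/
def uniformLaw {Ω : Type*} [Fintype Ω] (X : Ω → ℝ) : Measure ℝ :=
  ∑ ω, (Fintype.card Ω : ENNReal)⁻¹ • Measure.dirac (X ω)

instance uniformLaw.isProbabilityMeasure {Ω : Type*} [Fintype Ω] [Nonempty Ω] (X : Ω → ℝ) :
    IsProbabilityMeasure (uniformLaw X) := by
  constructor
  rw [uniformLaw, Measure.finsetSum_apply]
  simp [ENNReal.mul_inv_cancel]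

lemma uniformLaw_apply_toReal {Ω : Type*} [Fintype Ω] (X : Ω → ℝ) {E : Set ℝ}
    (hE : MeasurableSet E) :
    (uniformLaw X E).toReal =
      (Fintype.card Ω : ℝ)⁻¹ * ((Finset.univ.filter fun ω => X ω ∈ E).card : ℝ) := by
  rw [uniformLaw, Measure.finsetSum_apply]
  simp_rw [Measure.smul_apply, Measure.dirac_apply' _ hE, Set.indicator_apply, Pi.one_apply,
    smul_eq_mul, ← Finset.mul_sum, Finset.sum_boole]
  simp

lemma charFun_uniformLaw {Ω : Type*} [Fintype Ω] [Nonempty Ω] (X : Ω → ℝ) (θ : ℝ) :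
    charFun (uniformLaw X) θ = 𝔼 ω, Complex.exp (Complex.I * ((θ * X ω : ℝ) : ℂ)) := by
  rw [charFun_apply_real, uniformLaw, integral_finsetSum_measure]
  · simp_rw [integral_smul_measure, integral_dirac]
    rw [Fintype.expect_eq_sum_div_card, Finset.sum_div]
    refine Finset.sum_congr rfl fun ω _ => ?_
    rw [ENNReal.toReal_inv, ENNReal.toReal_natCast, div_eq_inv_mul, Complex.real_smul]
    push_cast
    ring_nf
  · intro ω _
    refine Integrable.smul_measure ?_ (by simp)
    exact integrable_dirac (by simp)

lemma gaussianReal_Iio_toReal (w : ℝ) : (gaussianReal 0 1 (Set.Iio w)).toReal = PhiCDF w := by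
  rw [gaussianReal_apply_eq_integral 0 one_ne_zero, ENNReal.toReal_ofReal
    (setIntegral_nonneg measurableSet_Iio fun x _ => gaussianPDFReal_nonneg _ _ _), PhiCDF,
    ← integral_const_mul]
  simp [gaussianPDFReal]

lemma tendsto_fraction_lt {Ω : ℕ → Type*} [∀ m, Fintype (Ω m)] [∀ m, Nonempty (Ω m)]
    (X : ∀ m, Ω m → ℝ)
    (h : ∀ θ : ℝ, Tendsto (fun m => 𝔼 ω, Complex.exp (Complex.I * ((θ * X m ω : ℝ) : ℂ))) atTop
      (nhds ((Real.exp (-(θ ^ 2 / 2)) : ℝ) : ℂ))) (w : ℝ) :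
    Tendsto (fun m => (Fintype.card (Ω m) : ℝ)⁻¹ *
      ((Finset.univ.filter fun ω => X m ω < w).card : ℝ)) atTop (nhds (PhiCDF w)) := by
  let μ : ℕ → ProbabilityMeasure ℝ := fun m => ⟨uniformLaw (X m), inferInstance⟩
  let μ₀ : ProbabilityMeasure ℝ := ⟨gaussianReal 0 1, inferInstance⟩
  have hlim : Tendsto μ atTop (nhds μ₀) := by
    refine ProbabilityMeasure.tendsto_of_tendsto_charFun fun θ => ?_
    have h1 : charFun (μ₀ : Measure ℝ) θ = ((Real.exp (-(θ ^ 2 / 2)) : ℝ) : ℂ) := by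
      change charFun (gaussianReal 0 1) θ = _
      rw [charFun_gaussianReal]
      push_cast
      congr 1
      ring
    rw [h1]
    exact (h θ).congr fun m => (charFun_uniformLaw (X m) θ).symm
  have hfr : (μ₀ : Measure ℝ) (frontier (Set.Iio w)) = 0 := by
    change gaussianReal 0 1 (frontier (Set.Iio w)) = 0
    have := nullSingletonClass_gaussianReal (μ := 0) (v := 1) one_ne_zero
    rw [frontier_Iio, measure_singleton]
  have h2 := ProbabilityMeasure.tendsto_measure_of_null_frontier_of_tendsto' hlim hfr
  have h3 := (ENNReal.tendsto_toReal (measure_ne_top (μ₀ : Measure ℝ) _)).comp h2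
  rw [← gaussianReal_Iio_toReal]
  refine h3.congr fun m => ?_
  exact uniformLaw_apply_toReal (X m) measurableSet_Iio

end Levy

section Asymptotics

/-- The rate of the normal approximation. -/
def cltRate (K : ℝ) (s m t L : ℕ) : ℝ :=
  K * (2 ^ t) ^ 4 * (2 * L + 1) ^ (s + 3) / (m + 1)

lemma moment_ratio_bounds {r : ℕ} {M L n κ v K q b δ : ℝ} (hM : 1 ≤ M) (hL : 0 ≤ L) (hn : 1 ≤ n)
    (hκ : 0 < κ) (hκ1 : κ ≤ 1) (hK : 1 ≤ K) (hv : κ * n ^ (r + 1) ≤ v)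
    (hq : q ≤ K * (n ^ (r + 1) * (n ^ r * (L * (L * L)))))
    (hb : b ≤ (2 * L + 1) ^ (r + 2) * (n ^ (r + 1) * L))
    (hδ : δ = K / κ ^ 2 * M ^ 4 * (2 * L + 1) ^ (r + 5) / n) :
    M ^ 2 * (n ^ r * L) ≤ δ * v ∧ n * (M ^ 2 * (n ^ r * L)) ^ 2 ≤ δ * v ^ 2 ∧
      M ^ 4 * q ≤ δ * v ^ 2 ∧ M ^ 4 * b ≤ δ * v ^ 2 := by
  have hn0 : 0 < n := by linarith
  have hM0 : 0 < M := by linarith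
  have hl : 1 ≤ 2 * L + 1 := by linarith
  have hLl : L ≤ 2 * L + 1 := by linarith
  have hδ0 : 0 ≤ δ := by rw [hδ]; positivity
  have e1 : K * M ^ 4 * (2 * L + 1) ^ (r + 5) * n ^ r ≤ δ * v := by
    calc K * M ^ 4 * (2 * L + 1) ^ (r + 5) * n ^ r
        ≤ K * M ^ 4 * (2 * L + 1) ^ (r + 5) * n ^ r * κ⁻¹ :=
          le_mul_of_one_le_right (by positivity) (one_le_inv_iff₀.mpr ⟨hκ, hκ1⟩)
      _ = δ * (κ * n ^ (r + 1)) := by rw [hδ]; field_simp; ring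
      _ ≤ δ * v := by gcongr
  have e2 : K * M ^ 4 * (2 * L + 1) ^ (r + 5) * (n ^ r * n ^ (r + 1)) ≤ δ * v ^ 2 := by
    calc K * M ^ 4 * (2 * L + 1) ^ (r + 5) * (n ^ r * n ^ (r + 1))
        = δ * (κ * n ^ (r + 1)) ^ 2 := by rw [hδ]; field_simp; ring
      _ ≤ δ * v ^ 2 := by gcongr
  have l1 : L ≤ (2 * L + 1) ^ (r + 5) := hLl.trans (le_self_pow₀ hl (by omega))
  have l2 : L * L ≤ (2 * L + 1) ^ (r + 5) := by
    calc L * L ≤ (2 * L + 1) * (2 * L + 1) := by gcongr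
      _ = (2 * L + 1) ^ 2 := by ring
      _ ≤ _ := pow_le_pow_right₀ hl (by omega)
  have l3 : L * (L * L) ≤ (2 * L + 1) ^ (r + 5) := by
    calc L * (L * L) ≤ (2 * L + 1) * ((2 * L + 1) * (2 * L + 1)) := by gcongr
      _ = (2 * L + 1) ^ 3 := by ring
      _ ≤ _ := pow_le_pow_right₀ hl (by omega)
  have l4 : (2 * L + 1) ^ (r + 2) * L ≤ (2 * L + 1) ^ (r + 5) := by
    calc (2 * L + 1) ^ (r + 2) * L ≤ (2 * L + 1) ^ (r + 2) * (2 * L + 1) := by gcongr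
      _ = (2 * L + 1) ^ (r + 3) := by ring
      _ ≤ _ := pow_le_pow_right₀ hl (by omega)
  refine ⟨le_trans ?_ e1, le_trans ?_ e2, le_trans ?_ e2, le_trans ?_ e2⟩
  · calc M ^ 2 * (n ^ r * L) ≤ M ^ 4 * (n ^ r * (2 * L + 1) ^ (r + 5)) := by
          gcongr
          · norm_num
      _ ≤ K * (M ^ 4 * (n ^ r * (2 * L + 1) ^ (r + 5))) := le_mul_of_one_le_left (by positivity) hK
      _ = _ := by ring
  · calc n * (M ^ 2 * (n ^ r * L)) ^ 2 = M ^ 4 * ((n ^ r * n ^ (r + 1)) * (L * L)) := by ring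
      _ ≤ M ^ 4 * ((n ^ r * n ^ (r + 1)) * (2 * L + 1) ^ (r + 5)) := by gcongr
      _ ≤ K * (M ^ 4 * ((n ^ r * n ^ (r + 1)) * (2 * L + 1) ^ (r + 5))) :=
          le_mul_of_one_le_left (by positivity) hK
      _ = _ := by ring
  · calc M ^ 4 * q ≤ M ^ 4 * (K * (n ^ (r + 1) * (n ^ r * (L * (L * L))))) := by gcongr
      _ ≤ M ^ 4 * (K * (n ^ (r + 1) * (n ^ r * (2 * L + 1) ^ (r + 5)))) := by gcongr
      _ = _ := by ring
  · calc M ^ 4 * b ≤ M ^ 4 * ((2 * L + 1) ^ (r + 2) * (n ^ (r + 1) * L)) := by gcongr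
      _ = M ^ 4 * (n ^ (r + 1) * ((2 * L + 1) ^ (r + 2) * L)) := by ring
      _ ≤ M ^ 4 * (n ^ (r + 1) * (2 * L + 1) ^ (r + 5)) := by gcongr
      _ ≤ (K * n ^ r) * (M ^ 4 * (n ^ (r + 1) * (2 * L + 1) ^ (r + 5))) :=
          le_mul_of_one_le_left (by positivity) (one_le_mul_of_one_le_of_one_le hK
            (one_le_pow₀ hn))
      _ = _ := by ring

/-- The width of the window of entry sums. -/
def windowWidth (m t : ℕ) : ℕ := ⌈V0 m⌉₊ + t

lemma tendsto_cltRate (K : ℝ) (hK : 0 ≤ K) (s : ℕ) {t : ℕ → ℕ}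
    (ht : ∀ m, (t m : ℝ) ≤ Real.logb 2 m / 10) :
    Tendsto (fun m => cltRate K s m (t m) (windowWidth m (t m))) atTop (nhds 0) := by
  set a : ℝ := 24 / Real.log 2 with ha
  have ha0 : 0 ≤ a := by positivity
  have hlim : Tendsto (fun m : ℕ => K * a ^ (s + 3) *
      (Real.log m ^ ((s + 3 : ℕ) : ℝ) / (m : ℝ) ^ (1 / 2 : ℝ))) atTop (nhds 0) := by
    have h := (isLittleO_log_rpow_rpow_atTop ((s + 3 : ℕ) : ℝ)
      (show (0 : ℝ) < 1 / 2 by norm_num)).tendsto_div_nhds_zero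
    simpa using (h.comp tendsto_natCast_atTop_atTop).const_mul (K * a ^ (s + 3))
  refine squeeze_zero' (Eventually.of_forall fun m => by unfold cltRate; positivity) ?_ hlim
  filter_upwards [eventually_ge_atTop 2] with m hm
  have hm1 : (1 : ℝ) ≤ m := by exact_mod_cast (by omega : 1 ≤ m)
  have hm0 : (0 : ℝ) < m := by linarith
  have hlog : 1 ≤ Real.logb 2 m := by
    rw [Real.le_logb_iff_rpow_le (by norm_num) hm0, Real.rpow_one]
    exact_mod_cast hm
  have hM : ((2 : ℝ) ^ t m) ^ 4 ≤ (m : ℝ) ^ (1 / 2 : ℝ) := by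
    calc ((2 : ℝ) ^ t m) ^ 4 = (2 : ℝ) ^ ((t m : ℝ) * 4) := by
          rw [Real.rpow_mul (by norm_num), Real.rpow_natCast]
          norm_cast
      _ ≤ (2 : ℝ) ^ (Real.logb 2 m * (1 / 2)) :=
          Real.rpow_le_rpow_of_exponent_le (by norm_num) (by linarith [ht m])
      _ = (m : ℝ) ^ (1 / 2 : ℝ) := by
          rw [Real.rpow_mul (by norm_num), Real.rpow_logb (by norm_num) (by norm_num) hm0]
  have hL : 2 * (windowWidth m (t m) : ℝ) + 1 ≤ a * Real.log m := by
    have h1 : (⌈V0 m⌉₊ : ℝ) < V0 m + 1 := Nat.ceil_lt_add_one (by unfold V0; linarith)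
    have h2 : a * Real.log m = 24 * Real.logb 2 m := by
      rw [ha, Real.logb]; ring
    rw [h2, windowWidth]
    push_cast
    unfold V0 at h1 ⊢
    linarith [ht m]
  unfold cltRate
  rw [Real.rpow_natCast]
  have hsq : (m : ℝ) ^ (1 / 2 : ℝ) * (m : ℝ) ^ (1 / 2 : ℝ) = m := by
    rw [← Real.rpow_add hm0]; norm_num
  have hr : 0 < (m : ℝ) ^ (1 / 2 : ℝ) := Real.rpow_pos_of_pos hm0 _
  calc _ ≤ K * (m : ℝ) ^ (1 / 2 : ℝ) * (a * Real.log m) ^ (s + 3) / m := by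
        gcongr
        linarith
    _ = K * a ^ (s + 3) * (Real.log m ^ (s + 3) * ((m : ℝ) ^ (1 / 2 : ℝ) / m)) := by
        rw [mul_pow]
        ring
    _ = _ := by
        congr 2
        exact eq_inv_of_mul_eq_one_left (by rw [div_mul_eq_mul_div, hsq, div_self hm0.ne'])

end Asymptotics

section Net

variable {m s tm : ℕ} {C : Fin s → Matrix (Fin m) (Fin m) (ZMod 2)}

/-- The coefficient of `r_A` in `Ψ_A`. -/
def psiCoeff (m s : ℕ) (C : Fin s → Matrix (Fin m) (Fin m) (ZMod 2)) (A : Fin s → ℕ)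
    (z : Fin s → Fin m → Fin 2) : ℝ :=
  (-1) ^ kapF A * (2 : ℝ) ^ ((m : ℤ) - (s : ℤ) - (a0F A : ℤ)) * LamZ m s C A z

/-- The union of the index sets `I_{m,s,k}`, `1 ≤ k ≤ m`. -/
def window (m s tm : ℕ) : Finset (Fin s → ℕ) :=
  (Fintype.piFinset fun _ : Fin s => Finset.range (m + 1)).filter fun A =>
    (m : ℝ) - tm < a0F A ∧ (a0F A : ℝ) < m + V0 m

lemma mem_window {A : Fin s → ℕ} : A ∈ window m s tm ↔
    (∀ i, A i ≤ m) ∧ (m : ℝ) - tm < a0F A ∧ (a0F A : ℝ) < m + V0 m := by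
  rw [window, Finset.mem_filter, Fintype.mem_piFinset]
  simp only [Finset.mem_range, Nat.lt_succ_iff]

lemma inWindow_window (htm : tm ≤ m) :
    InWindow (window m s tm) m (m - tm) (windowWidth m tm) := by
  intro A hA
  obtain ⟨h1, h2, h3⟩ := mem_window.mp hA
  refine ⟨h1, ?_, ?_⟩
  · rw [← Nat.cast_sub htm] at h2
    exact_mod_cast h2
  · have h4 : (a0F A : ℝ) < (m + ⌈V0 m⌉₊ : ℕ) := by
      push_cast
      linarith [Nat.le_ceil (V0 m)]
    have h5 : a0F A < m + ⌈V0 m⌉₊ := by exact_mod_cast h4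
    unfold windowWidth
    omega

lemma sum_DDk_eq_radSum (htm : tm ≤ m) (t y : Fin s → Fin m → Fin 2) :
    ∑ k ∈ Finset.Icc 1 m, DDk m s tm C k t y =
      radSum (psiCoeff m s C) (window m s tm) (t + y, y) := by
  have h1 : ∀ k, IndexSet m s tm k = (window m s tm).filter fun A => Finset.univ.sup A = k := by
    intro k
    ext A
    simp only [IndexSet, window, Finset.mem_filter]
    tauto
  have h2 : ∀ A ∈ window m s tm, Finset.univ.sup A ∈ Finset.Icc 1 m := by
    intro A hA
    obtain ⟨h3, h4, -⟩ := inWindow_window htm A hA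
    rw [Finset.mem_Icc]
    refine ⟨?_, Finset.sup_le fun i _ => h3 i⟩
    by_contra! h5
    have h6 : a0F A = 0 := Finset.sum_eq_zero fun i hi => by
      have := Finset.le_sup (f := A) hi
      omega
    omega
  simp only [DDk, h1]
  rw [Finset.sum_fiberwise_of_maps_to h2, radSum]
  refine Finset.sum_congr rfl fun A _ => ?_
  rw [PsiF, psiCoeff, LamF_eq_LamZ]
  ring

lemma abs_psiCoeff_le (hs : 0 < s) (htm : tm ≤ m)
    (hnet : IsNet tm m s fun n : Fin (2 ^ m) => netPoint m s C (n : ℕ)) {A : Fin s → ℕ}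
    (hA : A ∈ window m s tm) (z : Fin s → Fin m → Fin 2) : |psiCoeff m s C A z| ≤ 2 ^ tm := by
  obtain ⟨-, h1, -⟩ := inWindow_window htm A hA
  have h2 : ((dualBox m s C A).card : ℝ) ≤ 2 ^ (a0F A - (m - tm)) := by
    exact_mod_cast card_dualBox_le hs htm hnet h1.le
  rw [psiCoeff, abs_mul, abs_mul, abs_pow, abs_neg, abs_one, one_pow, one_mul,
    abs_of_pos (by positivity : (0 : ℝ) < 2 ^ ((m : ℤ) - (s : ℤ) - (a0F A : ℤ)))]
  calc _ ≤ (2 : ℝ) ^ ((m : ℤ) - (s : ℤ) - (a0F A : ℤ)) * 2 ^ (a0F A - (m - tm)) := by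
        gcongr
        exact (abs_LamZ_le m s C A z).trans h2
    _ = (2 : ℝ) ^ ((tm : ℤ) - s) := by
        rw [← zpow_natCast, ← zpow_add₀ (by norm_num)]
        congr 1
        omega
    _ ≤ (2 : ℝ) ^ (tm : ℤ) := zpow_le_zpow_right₀ (by norm_num) (by omega)
    _ = 2 ^ tm := zpow_natCast _ _

lemma psiCoeff_sq (A : Fin s → ℕ) (z : Fin s → Fin m → Fin 2) : psiCoeff m s C A z ^ 2 =
    ((2 : ℝ) ^ ((m : ℤ) - (s : ℤ) - (a0F A : ℤ))) ^ 2 * LamZ m s C A z ^ 2 := by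
  rw [psiCoeff, mul_pow, mul_pow, ← pow_mul, mul_comm (kapF A), pow_mul, neg_one_sq, one_pow,
    one_mul]

lemma expect_psiCoeff_sq_mul (hs : 0 < s) (htm : tm ≤ m)
    (hnet : IsNet tm m s fun n : Fin (2 ^ m) => netPoint m s C (n : ℕ)) {A B : Fin s → ℕ}
    (h : a0F (A ⊓ B) ≤ m - tm) :
    𝔼 z, psiCoeff m s C A z ^ 2 * psiCoeff m s C B z ^ 2 =
      (𝔼 z, psiCoeff m s C A z ^ 2) * 𝔼 z, psiCoeff m s C B z ^ 2 := by
  simp_rw [psiCoeff_sq]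
  rw [Finset.expect_congr rfl fun z _ => mul_mul_mul_comm _ (LamZ m s C A z ^ 2) _ _]
  simp_rw [← Finset.mul_expect]
  rw [expect_LamZ_sq_mul (dualBox_eq_empty hs htm hnet h)]
  ring

/-- The constant in the lower bound for the variance. -/
def varConst (s : ℕ) : ℝ := (1 / 4) ^ (s + 1) * (1 / (2 * s)) ^ (s - 1)

lemma varConst_mul_pow_le (hs : 2 ≤ s) (hm : 2 ≤ m) (hsm : s ≤ m) :
    varConst s * (m + 1 : ℝ) ^ (s - 1) ≤
      ∑ A ∈ window m s tm, 𝔼 z, psiCoeff m s C A z ^ 2 := by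
  set T := (window m s tm).filter fun A => a0F A = m + 1 with hT
  have hV : 1 < V0 m := by
    have hm0 : (0 : ℝ) < m := by exact_mod_cast (by omega : 0 < m)
    have hlog : 1 ≤ Real.logb 2 m := by
      rw [Real.le_logb_iff_rpow_le (by norm_num) hm0, Real.rpow_one]
      exact_mod_cast hm
    unfold V0
    linarith
  have hcard : (m / s) ^ (s - 1) ≤ T.card := by
    refine pow_le_card_diagonal hs ⟨0, by omega⟩ fun A hA h0 => ?_
    rw [hT, Finset.mem_filter, mem_window]
    refine ⟨⟨hA, ?_, ?_⟩, h0⟩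
    · rw [h0]; push_cast
      have : (0 : ℝ) ≤ tm := Nat.cast_nonneg _
      linarith
    · rw [h0]; push_cast; linarith
  have hterm : ∀ A ∈ T, (1 / 4 : ℝ) ^ (s + 1) ≤ 𝔼 z, psiCoeff m s C A z ^ 2 := by
    intro A hA
    rw [hT, Finset.mem_filter, mem_window] at hA
    simp_rw [psiCoeff_sq, ← Finset.mul_expect, expect_LamZ_sq]
    have h1 : (1 : ℝ) ≤ (dualBox m s C A).card := by
      exact_mod_cast (dualBox_nonempty C hA.1.1 (by omega)).card_pos
    have h2 : ((2 : ℝ) ^ ((m : ℤ) - (s : ℤ) - (a0F A : ℤ))) ^ 2 = (1 / 4) ^ (s + 1) := by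
      rw [hA.2, show (m : ℤ) - s - ((m + 1 : ℕ) : ℤ) = -((s + 1 : ℕ) : ℤ) by push_cast; ring,
        zpow_neg, zpow_natCast, ← inv_pow, ← pow_mul, mul_comm, pow_mul]
      norm_num
    rw [h2]
    exact le_mul_of_one_le_right (by positivity) h1
  have hs0 : (0 : ℝ) < s := by exact_mod_cast (by omega : 0 < s)
  have hdiv : 1 / (2 * s) * (m + 1 : ℝ) ≤ (m / s : ℕ) := by
    have h1 : m < s * (m / s + 1) := Nat.lt_mul_div_succ m (by omega)
    have h2 : 1 ≤ m / s := Nat.div_pos hsm (by omega)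
    have h3 : m + 1 ≤ (m / s) * (2 * s) := by nlinarith
    have h4 : (m + 1 : ℝ) ≤ (m / s : ℕ) * (2 * s) := by exact_mod_cast h3
    rw [one_div_mul_eq_div, div_le_iff₀ (by positivity)]
    exact h4
  calc varConst s * (m + 1 : ℝ) ^ (s - 1)
      = (1 / (2 * s) * (m + 1 : ℝ)) ^ (s - 1) * (1 / 4) ^ (s + 1) := by
        rw [varConst, mul_pow]; ring
    _ ≤ ((m / s : ℕ) : ℝ) ^ (s - 1) * (1 / 4) ^ (s + 1) := by gcongr
    _ ≤ (T.card : ℝ) * (1 / 4) ^ (s + 1) := by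
        gcongr
        exact_mod_cast hcard
    _ ≤ ∑ A ∈ T, 𝔼 z, psiCoeff m s C A z ^ 2 := by
        rw [← nsmul_eq_mul]
        exact Finset.card_nsmul_le_sum _ _ _ hterm
    _ ≤ _ := Finset.sum_le_sum_of_subset_of_nonneg (Finset.filter_subset _ _) fun A _ _ =>
        Finset.expect_nonneg fun z _ => sq_nonneg _

/-- The constant in the rate of the normal approximation. -/
def rateConst (s : ℕ) : ℝ := 3 ^ s * s / varConst s ^ 2

lemma norm_expect_exp_window_sub_le (hs : 2 ≤ s) (hm : 2 ≤ m) (hsm : s ≤ m) (htm : tm ≤ m)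
    (hnet : IsNet tm m s fun n : Fin (2 ^ m) => netPoint m s C (n : ℕ)) {ρ δ : ℝ} (hρ : 0 ≤ ρ)
    (hρ2 : ρ ^ 2 = ∑ A ∈ window m s tm, 𝔼 z, psiCoeff m s C A z ^ 2)
    (hδ : δ = cltRate (rateConst s) s m tm (windowWidth m tm)) (θ : ℝ) :
    ‖𝔼 ω, Complex.exp (Complex.I *
          ((θ * (radSum (psiCoeff m s C) (window m s tm) ω / ρ) : ℝ) : ℂ)) -
        ((Real.exp (-(θ ^ 2 / 2)) : ℝ) : ℂ)‖ ≤
      |θ| * Real.sqrt δ + 8 * θ ^ 4 * δ + θ ^ 2 / 2 * (2 * Real.sqrt δ + δ) := by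
  have hI := inWindow_window (s := s) htm
  have hv := varConst_mul_pow_le (tm := tm) (C := C) hs hm hsm
  rw [← hρ2] at hv
  have hs0 : (2 : ℝ) ≤ s := by exact_mod_cast hs
  have hκ : 0 < varConst s := by unfold varConst; positivity
  have hκ1 : varConst s ≤ 1 := by
    refine mul_le_one₀ (pow_le_one₀ (by norm_num) (by norm_num)) (by positivity)
      (pow_le_one₀ (by positivity) ?_)
    rw [div_le_one (by positivity)]
    linarith
  have hρ0 : 0 < ρ := by
    refine lt_of_le_of_ne hρ fun h => ?_
    rw [← h] at hv
    have : 0 < varConst s * (m + 1 : ℝ) ^ (s - 1) := by positivity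
    norm_num at hv
    linarith
  have h01 : (⟨1, by omega⟩ : Fin s) ≠ ⟨0, by omega⟩ := by simp
  have hquads := card_quads_le hI ⟨0, by omega⟩
  have hclose : (closePairs (window m s tm) (m - tm)).card ≤ (2 * windowWidth m tm + 1) ^ s *
      ((m + 1) ^ (s - 1) * windowWidth m tm) :=
    (card_close_le hI).trans (Nat.mul_le_mul_left _ (card_window_le hI ⟨0, by omega⟩))
  obtain ⟨r, rfl⟩ : ∃ r, s = r + 2 := ⟨s - 2, by omega⟩
  simp only [show r + 2 - 1 = r + 1 by omega, show r + 2 - 2 = r by omega] at hquads hclose hv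
  have hquads' := (Nat.cast_le (α := ℝ)).mpr hquads
  have hclose' := (Nat.cast_le (α := ℝ)).mpr hclose
  rw [Nat.cast_mul, Nat.cast_mul _ (r + 2)] at hquads'
  push_cast at hquads' hclose'
  obtain ⟨b1, b2, b3, b4⟩ := moment_ratio_bounds (r := r) (M := 2 ^ tm) (L := windowWidth m tm)
    (n := m + 1) (κ := varConst (r + 2)) (v := ρ ^ 2) (K := 3 ^ (r + 2) * (r + 2 : ℕ)) (δ := δ)
    (one_le_pow₀ (by norm_num)) (Nat.cast_nonneg _) (by simp) hκ hκ1
    (one_le_mul_of_one_le_of_one_le (one_le_pow₀ (by norm_num)) (by linarith)) hv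
    (by push_cast; exact hquads') hclose' (by rw [hδ]; rfl)
  rw [← pow_mul ρ] at b2 b3 b4
  exact norm_expect_exp_radSum_sub_le hI (fun A hA z => abs_psiCoeff_le (by omega) htm hnet hA z)
    (fun A _ B _ h => expect_psiCoeff_sq_mul (by omega) htm hnet h) h01 hρ0 hρ2 b1 b2 b3 b4 θ

/-- The change of variables `(T, Y) ↦ (T ⊕ Y, Y)` at digit level. -/
def digitShear (s m : ℕ) :
    Equiv.Perm ((Fin s → Fin m → Fin 2) × (Fin s → Fin m → Fin 2)) where
  toFun p := (p.1 + p.2, p.2)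
  invFun p := (p.1 - p.2, p.2)
  left_inv p := by simp
  right_inv p := by simp

lemma card_digitPairs (s m : ℕ) :
    (Fintype.card ((Fin s → Fin m → Fin 2) × (Fin s → Fin m → Fin 2)) : ℝ)⁻¹ =
      (2 : ℝ) ^ (-(2 * s * m : ℤ)) := by
  rw [zpow_neg]
  congr 1
  simp only [Fintype.card_prod, Fintype.card_fun, Fintype.card_fin]
  rw [← pow_mul, ← pow_add]
  push_cast
  rw [← zpow_natCast]
  congr 1
  push_cast
  ring

lemma Em_eq_expect (m s : ℕ)
    (f : (Fin s → Fin m → Fin 2) → (Fin s → Fin m → Fin 2) → ℝ) :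
    Em m s f = 𝔼 ω : (Fin s → Fin m → Fin 2) × (Fin s → Fin m → Fin 2), f ω.1 ω.2 := by
  rw [Em, Fintype.expect_eq_sum_div_card, ← card_digitPairs, Fintype.sum_prod_type, div_eq_inv_mul]

lemma Em_sum_DDk_sq (htm : tm ≤ m) :
    (Em m s fun t y => (∑ k ∈ Finset.Icc 1 m, DDk m s tm C k t y) ^ 2) =
      ∑ A ∈ window m s tm, 𝔼 z, psiCoeff m s C A z ^ 2 := by
  rw [Em_eq_expect, ← expect_radSum_sq fun A hA => (mem_window.mp hA).1]
  refine Fintype.expect_equiv (digitShear s m) _ _ fun ω => ?_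
  rw [sum_DDk_eq_radSum htm]
  rfl

end Net

/-- Lemma 7: the normalized martingale sum `Ṡ_m/ρ̇_m`
converges weakly to the standard Gaussian: the fraction of digit choices with
`Ṡ_m/ρ̇_m < w` tends to `Φ(w)`. -/
theorem statement16 (s : ℕ) (hs : 2 ≤ s) (t : ℕ → ℕ)
    (C : (m : ℕ) → Fin s → Matrix (Fin m) (Fin m) (ZMod 2))
    (hnet : ∀ m, IsNet (t m) m s fun n : Fin (2 ^ m) => netPoint m s (C m) (n : ℕ))
    (ht : ∀ m, (t m : ℝ) ≤ Real.logb 2 m / 10) (w : ℝ) :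
    Tendsto (fun m : ℕ =>
        (2 : ℝ) ^ (-(2 * s * m : ℤ)) *
          ((Finset.univ.filter fun ty :
                (Fin s → Fin m → Fin 2) × (Fin s → Fin m → Fin 2) =>
              (∑ k ∈ Finset.Icc 1 m, DDk m s (t m) (C m) k ty.1 ty.2) /
                  Real.sqrt (Em m s fun t' y' =>
                    (∑ k ∈ Finset.Icc 1 m, DDk m s (t m) (C m) k t' y') ^ 2) < w).card : ℝ))
      atTop (nhds (PhiCDF w)) := by
  set X : ∀ m, (Fin s → Fin m → Fin 2) × (Fin s → Fin m → Fin 2) → ℝ := fun m ty =>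
    (∑ k ∈ Finset.Icc 1 m, DDk m s (t m) (C m) k ty.1 ty.2) /
      Real.sqrt (Em m s fun t' y' => (∑ k ∈ Finset.Icc 1 m, DDk m s (t m) (C m) k t' y') ^ 2)
    with hX
  suffices h : ∀ θ, Tendsto (fun m => 𝔼 ω, Complex.exp (Complex.I * ((θ * X m ω : ℝ) : ℂ)))
      atTop (nhds ((Real.exp (-(θ ^ 2 / 2)) : ℝ) : ℂ)) by
    refine (tendsto_fraction_lt X h w).congr fun m => ?_
    rw [card_digitPairs]
  intro θ
  have hs0 : (2 : ℝ) ≤ s := by exact_mod_cast hs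
  have hδ := tendsto_cltRate (rateConst s) (by unfold rateConst; positivity) s ht
  set δ : ℕ → ℝ := fun m => cltRate (rateConst s) s m (t m) (windowWidth m (t m)) with hδdef
  have hlim : Tendsto (fun m => |θ| * Real.sqrt (δ m) + 8 * θ ^ 4 * δ m +
      θ ^ 2 / 2 * (2 * Real.sqrt (δ m) + δ m)) atTop (nhds 0) := by
    have hsqrt : Tendsto (fun m => Real.sqrt (δ m)) atTop (nhds 0) := by
      simpa using hδ.sqrt
    simpa using ((hsqrt.const_mul |θ|).add (hδ.const_mul (8 * θ ^ 4))).add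
      (((hsqrt.const_mul 2).add hδ).const_mul (θ ^ 2 / 2))
  rw [tendsto_iff_norm_sub_tendsto_zero]
  refine squeeze_zero' (Eventually.of_forall fun _ => norm_nonneg _) ?_ hlim
  filter_upwards [eventually_ge_atTop s] with m hm
  have htm : t m ≤ m := by
    have h1 : Real.logb 2 m ≤ m := by
      rw [Real.logb_le_iff_le_rpow (by norm_num) (by exact_mod_cast (by omega : 0 < m)),
        Real.rpow_natCast]
      exact_mod_cast Nat.lt_two_pow_self.le
    have h2 : (t m : ℝ) ≤ m := by
      linarith [ht m, Nat.cast_nonneg (α := ℝ) m]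
    exact_mod_cast h2
  have hsq := Em_sum_DDk_sq (C := C m) htm
  have hnn : 0 ≤ ∑ A ∈ window m s (t m), 𝔼 z, psiCoeff m s (C m) A z ^ 2 :=
    Finset.sum_nonneg fun A _ => Finset.expect_nonneg fun z _ => sq_nonneg _
  refine le_of_eq_of_le ?_ (norm_expect_exp_window_sub_le hs (by omega) hm htm (hnet m)
    (Real.sqrt_nonneg _) (Real.sq_sqrt hnn) rfl θ)
  congr 2
  refine Fintype.expect_equiv (digitShear s m) _ _ fun ω => ?_
  rw [hX]
  dsimp only
  rw [hsq, sum_DDk_eq_radSum htm]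
  rfl
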